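/- arXiv:1301.4016 — 3 statements merged into one kernel-verified Lean document; each statement's English description precedes it below -/
import Mathlib

section
/- Assume t is even and t is congruent to neither 0 nor 1 modulo p. If t − 1 divides p^{2e} + 1 for some positive integer e, then g_t(x,y) has an absolutely irreducible factor over F_p. -/
open MvPolynomial

noncomputable section

namespace MvPolynomial

section LeadingForm

variable {σ R : Type*} [CommRing R]

/-- The homogeneous component of top degree. -/
def leadingForm (f : MvPolynomial σ R) : MvPolynomial σ R :=
  homogeneousComponent f.totalDegree f

lemma leadingForm_isHomogeneous (f : MvPolynomial σ R) :
    (leadingForm f).IsHomogeneous f.totalDegree :=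
  homogeneousComponent_isHomogeneous _ _

lemma totalDegree_sub_leadingForm_lt (f : MvPolynomial σ R) {n : ℕ} (hn : f.totalDegree ≤ n)
    (h : 0 < n) : (f - leadingForm f).totalDegree < n := by
  rw [totalDegree, Finset.sup_lt_iff (by simpa using h)]
  intro d hd
  rw [mem_support_iff, coeff_sub, leadingForm, coeff_homogeneousComponent] at hd
  have hd' : d.degree ≠ f.totalDegree := fun h => hd (by simp [h])
  rw [if_neg hd', sub_zero] at hd
  have hle : d.degree ≤ f.totalDegree := le_totalDegree (mem_support_iff.2 hd)
  exact (lt_of_le_of_ne hle hd').trans_le hn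

lemma leadingForm_ne_zero {f : MvPolynomial σ R} (hf : f ≠ 0) : leadingForm f ≠ 0 := by
  intro h
  rcases Nat.eq_zero_or_pos f.totalDegree with h0 | h0
  · rw [leadingForm, h0, homogeneousComponent_zero] at h
    rw [totalDegree_eq_zero_iff_eq_C] at h0
    exact hf (h0.trans h)
  · have := totalDegree_sub_leadingForm_lt f le_rfl h0
    simp [h] at this

lemma homogeneousComponent_eq_of_totalDegree_sub_lt {f h : MvPolynomial σ R} {n : ℕ}
    (hh : h.IsHomogeneous n) (hlt : (f - h).totalDegree < n) :
    homogeneousComponent n f = h := by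
  have := homogeneousComponent_eq_zero n (f - h) hlt
  rwa [map_sub, homogeneousComponent_eq_self hh, sub_eq_zero] at this

lemma totalDegree_eq_of_totalDegree_sub_lt {f h : MvPolynomial σ R} {n : ℕ}
    (hh : h.IsHomogeneous n) (h0 : h ≠ 0) (hlt : (f - h).totalDegree < n) :
    f.totalDegree = n := by
  apply le_antisymm
  · have := totalDegree_add (f - h) h
    rw [sub_add_cancel] at this
    exact this.trans (max_le hlt.le hh.totalDegree_le)
  · by_contra! hn
    exact h0 (homogeneousComponent_eq_of_totalDegree_sub_lt hh hlt ▸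
      homogeneousComponent_eq_zero n f hn)

lemma leadingForm_eq_of_totalDegree_sub_lt {f h : MvPolynomial σ R} {n : ℕ}
    (hh : h.IsHomogeneous n) (h0 : h ≠ 0) (hlt : (f - h).totalDegree < n) :
    leadingForm f = h := by
  rw [leadingForm, totalDegree_eq_of_totalDegree_sub_lt hh h0 hlt,
    homogeneousComponent_eq_of_totalDegree_sub_lt hh hlt]

lemma leadingForm_of_isHomogeneous {f : MvPolynomial σ R} {n : ℕ} (hf : f.IsHomogeneous n) :
    leadingForm f = f := by
  rcases eq_or_ne f 0 with rfl | h0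
  · simp [leadingForm]
  · rw [leadingForm, hf.totalDegree h0, homogeneousComponent_eq_self hf]

lemma totalDegree_leadingForm (f : MvPolynomial σ R) :
    (leadingForm f).totalDegree = f.totalDegree := by
  rcases eq_or_ne f 0 with rfl | h0
  · simp [leadingForm]
  · exact (leadingForm_isHomogeneous f).totalDegree (leadingForm_ne_zero h0)

lemma totalDegree_mul_sub_leadingForm_lt (f g : MvPolynomial σ R) {n : ℕ}
    (hn : f.totalDegree + g.totalDegree ≤ n) (h : 0 < n) :
    (f * (g - leadingForm g)).totalDegree < n := by
  rcases Nat.eq_zero_or_pos g.totalDegree with hg | hg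
  · rw [leadingForm_of_isHomogeneous ((totalDegree_zero_iff_isHomogeneous σ).1 hg)]
    simpa
  · have h1 := totalDegree_mul f (g - leadingForm g)
    have h2 := totalDegree_sub_leadingForm_lt g le_rfl hg
    omega

lemma leadingForm_mul [IsDomain R] (f g : MvPolynomial σ R) :
    leadingForm (f * g) = leadingForm f * leadingForm g := by
  rcases eq_or_ne f 0 with rfl | hf
  · simp [leadingForm]
  rcases eq_or_ne g 0 with rfl | hg
  · simp [leadingForm]
  have hhom := (leadingForm_isHomogeneous f).mul (leadingForm_isHomogeneous g)
  rcases Nat.eq_zero_or_pos (f.totalDegree + g.totalDegree) with h0 | h0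
  · obtain ⟨hf0, hg0⟩ := Nat.add_eq_zero_iff.1 h0
    rw [totalDegree_zero_iff_isHomogeneous σ] at hf0 hg0
    rw [leadingForm_of_isHomogeneous hf0, leadingForm_of_isHomogeneous hg0,
      leadingForm_of_isHomogeneous (hf0.mul hg0)]
  refine leadingForm_eq_of_totalDegree_sub_lt hhom
    (mul_ne_zero (leadingForm_ne_zero hf) (leadingForm_ne_zero hg)) ?_
  have e : f * g - leadingForm f * leadingForm g =
      f * (g - leadingForm g) + leadingForm g * (f - leadingForm f) := by ring
  rw [e]
  refine (totalDegree_add _ _).trans_lt (max_lt ?_ ?_)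
  · exact totalDegree_mul_sub_leadingForm_lt f g le_rfl h0
  · exact totalDegree_mul_sub_leadingForm_lt _ f (by rw [totalDegree_leadingForm, add_comm]) h0

end LeadingForm

section Field

variable {σ K : Type*} [Field K]

lemma isUnit_iff_totalDegree_eq_zero {f : MvPolynomial σ K} (hf : f ≠ 0) :
    IsUnit f ↔ f.totalDegree = 0 := by
  refine ⟨fun h => (isUnit_iff_totalDegree_of_isReduced.1 h).2, fun h => ?_⟩
  rw [totalDegree_eq_zero_iff_eq_C] at h
  rw [h] at hf ⊢
  exact (IsUnit.mk0 _ fun h0 => hf (by rw [h0, C_0])).map C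

/-- Polynomials of positive degree whose leading forms have no common factor are not coprime:
a weak form of Bézout's theorem. -/
lemma not_isCoprime_of_isRelPrime_leadingForm {a b : MvPolynomial σ K}
    (ha : 0 < a.totalDegree) (hb : 0 < b.totalDegree)
    (hab : IsRelPrime (leadingForm a) (leadingForm b)) : ¬ IsCoprime a b := by
  have ha0 : a ≠ 0 := by rintro rfl; simp at ha
  have hb0 : b ≠ 0 := by rintro rfl; simp at hb
  suffices H : ∀ (m : ℕ) (u v : MvPolynomial σ K), u.totalDegree = m → u * a + v * b ≠ 1 by
    rintro ⟨u, v, h⟩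
    exact H _ u v rfl h
  intro m
  induction m using Nat.strong_induction_on with
  | _ m ih =>
  intro u v hum h
  have hu : u ≠ 0 := by
    rintro rfl
    have := IsUnit.of_mul_eq_one_right v (by simpa using h)
    rw [isUnit_iff_totalDegree_eq_zero hb0] at this
    omega
  have hua := totalDegree_mul_of_isDomain hu ha0
  have hlead : leadingForm (-v * b) = leadingForm (u * a) := by
    have hpos : 0 < (u * a).totalDegree := by omega
    refine leadingForm_eq_of_totalDegree_sub_lt (leadingForm_isHomogeneous _)
      (leadingForm_ne_zero (mul_ne_zero hu ha0)) ?_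
    have e : -v * b - leadingForm (u * a) = (u * a - leadingForm (u * a)) - 1 := by
      rw [← h]; ring
    rw [e]
    refine (totalDegree_sub _ _).trans_lt (max_lt ?_ (by simpa using hpos))
    exact totalDegree_sub_leadingForm_lt _ le_rfl hpos
  have hdvd : leadingForm b ∣ leadingForm u := by
    refine hab.symm.dvd_of_dvd_mul_right (z := leadingForm a) ⟨leadingForm (-v), ?_⟩
    rw [← leadingForm_mul, ← hlead, leadingForm_mul, mul_comm]
  obtain ⟨w, hw⟩ := hdvd
  have hw0 : w ≠ 0 := by
    rintro rfl
    exact leadingForm_ne_zero hu (by simpa using hw)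
  have hdw := congrArg totalDegree hw
  rw [totalDegree_mul_of_isDomain (leadingForm_ne_zero hb0) hw0, totalDegree_leadingForm,
    totalDegree_leadingForm] at hdw
  refine ih (u - w * b).totalDegree ?_ (u - w * b) (v + w * a) rfl (by rw [← h]; ring)
  have e : u - w * b = (u - leadingForm u) - w * (b - leadingForm b) := by rw [hw]; ring
  rw [e]
  refine (totalDegree_sub _ _).trans_lt (max_lt ?_ ?_)
  · exact totalDegree_sub_leadingForm_lt u hum.le (by omega)
  · exact totalDegree_mul_sub_leadingForm_lt w b (by omega) (by omega)

lemma exists_common_zero_of_not_isCoprime [IsAlgClosed K] [Finite σ] {a b : MvPolynomial σ K}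
    (h : ¬ IsCoprime a b) : ∃ x : σ → K, eval x a = 0 ∧ eval x b = 0 := by
  have hne : Ideal.span {a, b} ≠ ⊤ := by
    rw [Ne, Ideal.eq_top_iff_one, Ideal.mem_span_pair]
    exact h
  obtain ⟨M, hM, hle⟩ := Ideal.exists_le_maximal _ hne
  obtain ⟨x, hx⟩ := (isMaximal_iff_eq_vanishingIdeal_singleton (K := K)).1 hM
  have hz : ∀ c ∈ ({a, b} : Set (MvPolynomial σ K)), eval x c = 0 := fun c hc => by
    have := hle (Ideal.subset_span hc)
    rw [hx, mem_vanishingIdeal_singleton_iff] at this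
    simpa [aeval_eq_eval] using this
  exact ⟨x, hz a (by simp), hz b (by simp)⟩

lemma isRelPrime_of_mul_dvd_sub_pow {n : ℕ} (hn : (n : K) ≠ 0) {k : K} (hk : k ≠ 0)
    {a b : MvPolynomial (Fin 2) K} (h : a * b ∣ C k * (X 0 ^ n - X 1 ^ n)) :
    IsRelPrime a b := by
  intro c hca hcb
  have h01 : IsRelPrime (X 0 : MvPolynomial (Fin 2) K) (X 1) := by
    rw [(X_prime (R := K) (i := (0 : Fin 2))).irreducible.isRelPrime_iff_not_dvd, X_dvd_X]
    simp
  obtain ⟨w, hw⟩ := (mul_dvd_mul hca hcb).trans h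
  have key (i : Fin 2) : c ∣ pderiv i (C k * (X 0 ^ n - X 1 ^ n)) := by
    rw [hw]
    simp only [pderiv_mul]
    exact ⟨pderiv i c * w + pderiv i c * w + c * pderiv i w, by ring⟩
  have hkn : IsUnit (C (k * n) : MvPolynomial (Fin 2) K) :=
    (IsUnit.mk0 _ (mul_ne_zero hk hn)).map C
  have h0 : c ∣ X 0 ^ (n - 1) := by
    have := key 0
    have e : pderiv 0 (C k * (X 0 ^ n - X 1 ^ n) : MvPolynomial (Fin 2) K) =
        C (k * n) * X 0 ^ (n - 1) := by
      rw [pderiv_C_mul, map_sub, pderiv_pow, pderiv_pow, pderiv_X_self,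
        pderiv_X_of_ne (by decide)]
      simp
      ring
    rwa [e, hkn.dvd_mul_left] at this
  have h1 : c ∣ X 1 ^ (n - 1) := by
    have := key 1
    have e : pderiv 1 (C k * (X 0 ^ n - X 1 ^ n) : MvPolynomial (Fin 2) K) =
        C (k * n) * -X 1 ^ (n - 1) := by
      rw [pderiv_C_mul, map_sub, pderiv_pow, pderiv_pow, pderiv_X_self,
        pderiv_X_of_ne (by decide)]
      simp
      ring
    rwa [e, hkn.dvd_mul_left, dvd_neg] at this
  exact h01.pow h0 h1

end Field

lemma totalDegree_add_one_pow_sub_lt {σ R : Type*} [CommRing R] (i : σ)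
    {n : ℕ} (hn : 0 < n) :
    ((X i + 1) ^ (n + 1) - X i ^ (n + 1) - C ((n + 1 : ℕ) : R) * X i ^ n :
      MvPolynomial σ R).totalDegree < n := by
  have e : ((X i + 1) ^ (n + 1) - X i ^ (n + 1) - C ((n + 1 : ℕ) : R) * X i ^ n :
      MvPolynomial σ R) = ∑ m ∈ Finset.range n, C ((n + 1).choose m : R) * X i ^ m := by
    rw [add_pow, Finset.sum_range_succ, Finset.sum_range_succ]
    simp [mul_comm]
  rw [e]
  refine (totalDegree_finsetSum _ _).trans_lt ((Finset.sup_lt_iff hn).2 fun m hm => ?_)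
  refine ((isHomogeneous_X_pow i m).C_mul _).totalDegree_le.trans_lt (Finset.mem_range.1 hm)

end MvPolynomial

/-- A critical value of `(x + 1) ^ (n + 1) - x ^ (n + 1)` is attained at only one critical point. -/
lemma eq_of_add_one_pow_eq_pow {K : Type*} [Field K] (p : ℕ) [Fact p.Prime] [CharP K p]
    (hp2 : p ≠ 2) {n k : ℕ} (hn : Odd n) (hdvd : n ∣ p ^ k + 1) {x y : K}
    (hx : (x + 1) ^ n = x ^ n) (hy : (y + 1) ^ n = y ^ n) (hxy : x ^ n = y ^ n) : x = y := by
  have frob : ∀ z : K, (z + 1) ^ n = z ^ n → z ^ p ^ k = -1 - z := by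
    intro z hz
    obtain ⟨m, hm⟩ := hdvd
    have : (z + 1) ^ (p ^ k + 1) = z ^ (p ^ k + 1) := by
      rw [hm, pow_mul, pow_mul, hz]
    rw [pow_succ, pow_succ, add_pow_char_pow, one_pow] at this
    linear_combination this
  have hprod : (x - y) * (1 + x + y) = 0 := by
    obtain ⟨m, hm⟩ := hdvd
    have : x ^ (p ^ k + 1) = y ^ (p ^ k + 1) := by rw [hm, pow_mul, pow_mul, hxy]
    rw [pow_succ, pow_succ, frob x hx, frob y hy] at this
    linear_combination -this
  rcases mul_eq_zero.1 hprod with h | h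
  · exact sub_eq_zero.1 h
  · exfalso
    have hyx : y = -(x + 1) := by linear_combination h
    rw [hyx, hn.neg_pow, hx] at hxy
    have h2 : (2 : K) ≠ 0 := Ring.two_ne_zero (by rwa [ringChar.eq K p])
    have hx0 : x ^ n = 0 := by
      have : 2 * x ^ n = 0 := by linear_combination hxy
      exact (mul_eq_zero.1 this).resolve_left h2
    have hx0' : x = 0 := pow_eq_zero_iff hn.pos.ne' |>.1 hx0
    rw [hx0'] at hx
    simp [hn.pos.ne'] at hx

/-- When `n` divides `p ^ k + 1`, the affine curve `g = 0` and its points at infinity are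
nonsingular, so `g` is irreducible. -/
theorem irreducible_of_add_one_pow_sub_eq {K : Type*} [Field K] [IsAlgClosed K] (p : ℕ)
    [Fact p.Prime] [CharP K p] {n : ℕ} {g : MvPolynomial (Fin 2) K} (hp2 : p ≠ 2)
    {k : ℕ} (hn : Odd n) (hn2 : 1 < n) (hdvd : n ∣ p ^ k + 1)
    (hn0 : (n : K) ≠ 0) (hn1 : ((n + 1 : ℕ) : K) ≠ 0)
    (hg : ((X 0 + 1) ^ (n + 1) - X 0 ^ (n + 1) - (X 1 + 1) ^ (n + 1) + X 1 ^ (n + 1) :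
      MvPolynomial (Fin 2) K) = (X 0 - X 1) * g) :
    0 < g.totalDegree ∧ Irreducible g := by
  have hform : (C ((n + 1 : ℕ) : K) * (X 0 ^ n - X 1 ^ n) :
      MvPolynomial (Fin 2) K).IsHomogeneous n :=
    ((isHomogeneous_X_pow 0 n).sub (isHomogeneous_X_pow 1 n)).C_mul _
  have hform0 : (C ((n + 1 : ℕ) : K) * (X 0 ^ n - X 1 ^ n) : MvPolynomial (Fin 2) K) ≠ 0 := by
    intro h
    have := congrArg (eval ![1, 0]) h
    simp only [map_mul, map_sub, map_pow, eval_C, eval_X, map_zero] at this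
    exact hn1 (by simpa [hn.pos.ne'] using this)
  have hlt : ((X 0 - X 1) * g - C ((n + 1 : ℕ) : K) * (X 0 ^ n - X 1 ^ n)).totalDegree < n := by
    have e : (X 0 - X 1) * g - C ((n + 1 : ℕ) : K) * (X 0 ^ n - X 1 ^ n) =
        ((X 0 + 1) ^ (n + 1) - X 0 ^ (n + 1) - C ((n + 1 : ℕ) : K) * X 0 ^ n) -
        ((X 1 + 1) ^ (n + 1) - X 1 ^ (n + 1) - C ((n + 1 : ℕ) : K) * X 1 ^ n) := by
      rw [← hg]; ring
    rw [e]
    exact (totalDegree_sub _ _).trans_lt (max_lt (totalDegree_add_one_pow_sub_lt 0 hn.pos)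
      (totalDegree_add_one_pow_sub_lt 1 hn.pos))
  have hX0 : (X 0 - X 1 : MvPolynomial (Fin 2) K) ≠ 0 := by
    rw [sub_ne_zero]
    exact fun h => by simpa using X_injective h
  have hXh : (X 0 - X 1 : MvPolynomial (Fin 2) K).IsHomogeneous 1 :=
    (isHomogeneous_X K 0).sub (isHomogeneous_X K 1)
  have hdeg := totalDegree_eq_of_totalDegree_sub_lt hform hform0 hlt
  have hlead := leadingForm_eq_of_totalDegree_sub_lt hform hform0 hlt
  have hg0 : g ≠ 0 := by
    rintro rfl
    simp at hdeg
    omega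
  rw [totalDegree_mul_of_isDomain hX0 hg0, hXh.totalDegree hX0] at hdeg
  refine ⟨by omega, fun hu => ?_, fun {a b} hab => ?_⟩
  · rw [isUnit_iff_totalDegree_eq_zero hg0] at hu
    omega
  by_contra! hnu
  have ha0 : a ≠ 0 := by rintro rfl; simp [hg0] at hab
  have hb0 : b ≠ 0 := by rintro rfl; simp [hg0] at hab
  rw [isUnit_iff_totalDegree_eq_zero ha0, isUnit_iff_totalDegree_eq_zero hb0] at hnu
  have hrel : IsRelPrime (leadingForm a) (leadingForm b) := by
    refine isRelPrime_of_mul_dvd_sub_pow hn0 hn1 ?_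
    rw [← hlead, hab, leadingForm_mul, leadingForm_mul]
    exact dvd_mul_left _ _
  obtain ⟨z, hza, hzb⟩ := exists_common_zero_of_not_isCoprime
    (not_isCoprime_of_isRelPrime_leadingForm (Nat.pos_of_ne_zero hnu.1)
      (Nat.pos_of_ne_zero hnu.2) hrel)
  rw [hab] at hg
  have d0 := congrArg (fun q => eval z (pderiv 0 q)) hg
  have d1 := congrArg (fun q => eval z (pderiv 1 q)) hg
  have d00 := congrArg (fun q => eval z (pderiv 0 (pderiv 0 q))) hg
  have v := congrArg (eval z) hg
  simp [hza, hzb, Derivation.leibniz, Derivation.leibniz_pow, pderiv_X] at d0 d1 d00 v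
  rw [Nat.cast_add_one] at hn1
  have hx : (z 0 + 1) ^ n = z 0 ^ n := mul_left_cancel₀ hn1 (by linear_combination d0)
  have hy : (z 1 + 1) ^ n = z 1 ^ n := mul_left_cancel₀ hn1 (by linear_combination -d1)
  have hxy : z 0 ^ n = z 1 ^ n := by
    linear_combination v - (z 0 + 1) * hx + (z 1 + 1) * hy
  have h01 := eq_of_add_one_pow_eq_pow p hp2 hn hdvd hx hy hxy
  rw [h01, sub_self, zero_mul, ← h01] at d00
  have hx' : (z 0 + 1) ^ (n - 1) = z 0 ^ (n - 1) :=
    mul_left_cancel₀ (mul_ne_zero hn1 hn0) (by linear_combination d00)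
  have hz : z 0 ^ (n - 1) = 0 := by
    obtain ⟨m, rfl⟩ : ∃ m, n = m + 1 := ⟨n - 1, by omega⟩
    rw [Nat.add_sub_cancel] at hx' ⊢
    linear_combination hx - (z 0 + 1) * hx'
  rw [pow_eq_zero_iff (by omega)] at hz
  simp [hz, hn.pos.ne'] at hx

/-- Case (A), condition (d): if `t` is even and `t-1` divides `p^{2e}+1` for
some positive integer `e`, then `g_t` has an absolutely irreducible factor
over `F_p`. -/
theorem gt_has_abs_irred_factor_of_dvd_pow_add_one
    (p t : ℕ) [Fact p.Prime] (hp2 : p ≠ 2) (ht : 3 ≤ t) (hpt : ¬ p ∣ t)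
    (g : MvPolynomial (Fin 2) (ZMod p))
    (hg : ((X 0 + 1) ^ t - X 0 ^ t - (X 1 + 1) ^ t + X 1 ^ t : MvPolynomial (Fin 2) (ZMod p))
        = (X 0 - X 1) * g)
    (hte : Even t) (h0 : t % p ≠ 0) (h1 : t % p ≠ 1)
    (e : ℕ) (he : 0 < e) (hdvd : (t - 1) ∣ p ^ (2 * e) + 1) :
    ∃ h : MvPolynomial (Fin 2) (ZMod p), 0 < h.totalDegree ∧ h ∣ g ∧
      Irreducible (MvPolynomial.map (algebraMap (ZMod p) (AlgebraicClosure (ZMod p))) h) := by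
  obtain ⟨n, rfl⟩ : ∃ n, t = n + 1 := ⟨t - 1, by omega⟩
  rw [Nat.add_sub_cancel] at hdvd
  have hg' := congrArg (MvPolynomial.map (algebraMap (ZMod p) (AlgebraicClosure (ZMod p)))) hg
  simp only [map_add, map_sub, map_mul, map_pow, map_X, map_one] at hg'
  have : CharP (AlgebraicClosure (ZMod p)) p :=
    charP_of_injective_algebraMap (algebraMap (ZMod p) _).injective p
  have hpn : ¬ p ∣ n := by
    intro h
    have h2 : p ∣ p ^ (2 * e) := dvd_pow_self p (by omega)
    exact (Fact.out : p.Prime).one_lt.ne'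
      (Nat.dvd_one.1 ((Nat.dvd_add_right h2).1 (h.trans hdvd)))
  obtain ⟨hpos, hirr⟩ := irreducible_of_add_one_pow_sub_eq p hp2
    (by simpa [Nat.even_add_one] using hte) (by omega) hdvd
    (by rwa [Ne, CharP.cast_eq_zero_iff _ p]) (by rwa [Ne, CharP.cast_eq_zero_iff _ p]) hg'
  rw [totalDegree, support_map_of_injective _ (algebraMap (ZMod p) _).injective] at hpos
  exact ⟨g, hpos, dvd_rfl, hirr⟩
end
end

section
/- Assume t is even and t is congruent to neither 0 nor 1 modulo p. If t − 1 ≥ 3 is a prime number and the multiplicative order of p in Z/(t−1)Z equals (t−2)/2, then g_t(x,y) has an absolutely irreducible factor over F_p. -/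
open MvPolynomial

noncomputable section

theorem pow_mul_pow_eq_of_modEq {K : Type*} [Field K] {l m n : ℕ} {a b : K} (hb : b ≠ 0)
    (hab : a ^ l = b ^ l) (h : m ≡ n [MOD l]) : a ^ m * b ^ n = a ^ n * b ^ m := by
  have hone : (a / b) ^ l = 1 := by rw [div_pow, hab, div_self (pow_ne_zero _ hb)]
  have key : (a / b) ^ m = (a / b) ^ n := pow_eq_pow_of_modEq h hone
  rw [div_pow, div_pow, div_eq_div_iff (pow_ne_zero _ hb) (pow_ne_zero _ hb)] at key
  exact key

/-- If `q` is a power of `p` modulo `l`, a coincidence of critical values of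
`(X + 1) ^ (l + 1) - X ^ (l + 1)` is a coincidence of values of `(X + 1) ^ q - X ^ q`. -/
theorem add_one_pow_sub_pow_eq {K : Type*} [Field K] (p : ℕ) [Fact p.Prime] [CharP K p]
    {l : ℕ} {x y : K} (hx0 : x ≠ 0) (hy0 : y ≠ 0) (hx : (x + 1) ^ l = x ^ l)
    (hy : (y + 1) ^ l = y ^ l) (hxy : x ^ l = y ^ l) {q : ℕ}
    (hq : ∃ k : ℕ, (q : ZMod l) = (p : ZMod l) ^ k) :
    (x + 1) ^ q - x ^ q = (y + 1) ^ q - y ^ q := by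
  obtain ⟨k, hk⟩ := hq
  have hmod : q ≡ p ^ k [MOD l] := by
    rw [← ZMod.natCast_eq_natCast_iff]; push_cast; exact hk
  have aux : ∀ z : K, z ≠ 0 → (z + 1) ^ l = z ^ l →
      ((z + 1) ^ q - z ^ q) * z ^ p ^ k = z ^ q := by
    intro z hz0 hz
    have h1 := pow_mul_pow_eq_of_modEq hz0 hz hmod
    have h2 : (z + 1) ^ p ^ k = z ^ p ^ k + 1 := by rw [add_pow_char_pow, one_pow]
    rw [h2] at h1
    linear_combination h1
  have h3 := pow_mul_pow_eq_of_modEq hy0 hxy hmod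
  have h4 : ((x + 1) ^ q - x ^ q) * (x ^ p ^ k * y ^ p ^ k) =
      ((y + 1) ^ q - y ^ q) * (x ^ p ^ k * y ^ p ^ k) := by
    linear_combination y ^ p ^ k * aux x hx0 hx - x ^ p ^ k * aux y hy0 hy + h3
  exact mul_right_cancel₀ (mul_ne_zero (pow_ne_zero _ hx0) (pow_ne_zero _ hy0)) h4

/-- If `p` has order `(l - 1) / 2` modulo the prime `l`, its powers form a subgroup of index two. -/
theorem exists_pow_eq_mul_iff {p l : ℕ} [Fact l.Prime] (hl : 3 ≤ l)
    (hord : orderOf (p : ZMod l) = (l - 1) / 2) {a b : ℕ} (ha : ¬ l ∣ a) (hb : ¬ l ∣ b) :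
    (∃ k : ℕ, ((a * b : ℕ) : ZMod l) = (p : ZMod l) ^ k) ↔
      ((∃ k : ℕ, (a : ZMod l) = (p : ZMod l) ^ k) ↔ ∃ k : ℕ, (b : ZMod l) = (p : ZMod l) ^ k) := by
  have hlp : l.Prime := Fact.out
  have hodd : l % 2 = 1 := hlp.eq_two_or_odd.resolve_left (by omega)
  have hp0 : (p : ZMod l) ≠ 0 := by
    intro h
    rw [h, orderOf_zero] at hord
    omega
  have ha0 : (a : ZMod l) ≠ 0 := by rwa [Ne, ZMod.natCast_eq_zero_iff]
  have hb0 : (b : ZMod l) ≠ 0 := by rwa [Ne, ZMod.natCast_eq_zero_iff]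
  set u : (ZMod l)ˣ := Units.mk0 _ hp0
  have hu : orderOf u = (l - 1) / 2 := by rw [← orderOf_units]; exact hord
  have hidx : (Subgroup.zpowers u).index = 2 := by
    have h1 := (Subgroup.zpowers u).card_mul_index
    rw [Nat.card_zpowers, hu, Nat.card_eq_fintype_card, ZMod.card_units] at h1
    have h2 : (l - 1) / 2 * 2 = l - 1 := by omega
    exact Nat.eq_of_mul_eq_mul_left (by omega) (h1.trans h2.symm)
  have hmem : ∀ c : (ZMod l)ˣ, c ∈ Subgroup.zpowers u ↔
      ∃ k : ℕ, (c : ZMod l) = (p : ZMod l) ^ k := by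
    intro c
    rw [← mem_powers_iff_mem_zpowers, Submonoid.mem_powers_iff]
    refine exists_congr fun k => ?_
    rw [Units.ext_iff, Units.val_pow_eq_pow_val, Units.val_mk0, eq_comm]
  have h := Subgroup.mul_mem_iff_of_index_two hidx
    (a := Units.mk0 _ ha0) (b := Units.mk0 _ hb0)
  rw [hmem, hmem, hmem] at h
  push_cast
  exact h

/-- The polynomial `(X + 1) ^ (l + 1) - X ^ (l + 1)` takes distinct values at its critical points,
the solutions of `(x + 1) ^ l = x ^ l`; its value at such a point is `x ^ l`. -/
theorem eq_of_critical_values_eq {K : Type*} [Field K] {p l : ℕ} [Fact p.Prime] [Fact l.Prime]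
    [CharP K p] (hp2 : p ≠ 2) (hl : 3 ≤ l) (hord : orderOf (p : ZMod l) = (l - 1) / 2)
    {x y : K} (hx0 : x ≠ 0) (hy0 : y ≠ 0) (hx : (x + 1) ^ l = x ^ l)
    (hy : (y + 1) ^ l = y ^ l) (hxy : x ^ l = y ^ l) : x = y := by
  have hlp : l.Prime := Fact.out
  have hpp : p.Prime := Fact.out
  have hodd : Odd l := hlp.odd_of_ne_two (by omega)
  have hpl : p ≠ l := by
    rintro rfl
    rw [CharP.cast_eq_zero, orderOf_zero] at hord
    omega
  have h2 : (2 : K) ≠ 0 := by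
    intro h
    have : p ∣ 2 := (CharP.cast_eq_zero_iff K p 2).1 (by exact_mod_cast h)
    exact hp2 ((Nat.prime_dvd_prime_iff_eq hpp Nat.prime_two).1 this)
  have hsum : x + y + 1 ≠ 0 := by
    intro h
    have h1 : y = -(x + 1) := by linear_combination h
    rw [h1, hodd.neg_pow, hx] at hxy
    have : 2 * x ^ l = 0 := by linear_combination hxy
    exact mul_ne_zero h2 (pow_ne_zero _ hx0) this
  have key := fun {q : ℕ} => add_one_pow_sub_pow_eq p hx0 hy0 hx hy hxy (q := q)
  by_contra hne
  have hsub : x - y ≠ 0 := sub_ne_zero.2 hne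
  have nd : ∀ q : ℕ, q.Prime → l ≠ q → ¬ l ∣ q := fun q hq h h' =>
    h ((Nat.prime_dvd_prime_iff_eq hlp hq).1 h')
  have nd2 : ¬ l ∣ 2 := nd 2 Nat.prime_two (by omega)
  have hmul := fun {a b : ℕ} => exists_pow_eq_mul_iff hl hord (a := a) (b := b)
  have n2 : ¬ ∃ k : ℕ, ((2 : ℕ) : ZMod l) = (p : ZMod l) ^ k := by
    intro h
    have := key h
    exact hsub (mul_left_cancel₀ h2 (by linear_combination this))
  have e4 := key ((hmul nd2 nd2).2 Iff.rfl)
  obtain ⟨w, hw⟩ : ∃ w, w = 2 * x + 1 := ⟨_, rfl⟩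
  obtain ⟨z, hz⟩ : ∃ z, z = 2 * y + 1 := ⟨_, rfl⟩
  obtain ⟨e, he⟩ : ∃ e, e = w + z := ⟨_, rfl⟩
  have hwz : w - z ≠ 0 := by
    have : w - z = 2 * (x - y) := by rw [hw, hz]; ring
    rw [this]; exact mul_ne_zero h2 hsub
  have he0 : e ≠ 0 := by
    have : e = 2 * (x + y + 1) := by rw [he, hw, hz]; ring
    rw [this]; exact mul_ne_zero h2 hsum
  have hH : w ^ 2 + w * z + z ^ 2 = -1 := by
    have : (x - y) * (w ^ 2 + w * z + z ^ 2 + 1) = 0 := by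
      rw [hw, hz]; linear_combination e4
    linear_combination (mul_eq_zero.1 this).resolve_left hsub
  by_cases h3 : (3 : K) = 0
  · have hp3 : p = 3 := by
      have : p ∣ 3 := (CharP.cast_eq_zero_iff K p 3).1 (by exact_mod_cast h3)
      exact (Nat.prime_dvd_prime_iff_eq hpp Nat.prime_three).1 this
    subst hp3
    have hl5 : l ≠ 5 := by
      rintro rfl
      have h : ((3 : ℕ) : ZMod 5) ^ ((5 - 1) / 2) = 1 := by
        rw [← hord]; exact pow_orderOf_eq_one _
      have h' : ((3 ^ 2 : ℕ) : ZMod 5) = ((1 : ℕ) : ZMod 5) := by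
        rw [Nat.cast_pow, Nat.cast_one]; exact h
      exact absurd ((ZMod.natCast_eq_natCast_iff _ _ _).1 h') (by decide)
    have nd5 := nd 5 Nat.prime_five hl5
    by_cases n5 : ∃ k : ℕ, ((5 : ℕ) : ZMod l) = ((3 : ℕ) : ZMod l) ^ k
    · have e5 := key n5
      have h5 : (w - z) * (e * (5 * (w ^ 2 + z ^ 2 + 2))) = 0 := by
        rw [he, hw, hz]; linear_combination 16 * e5
      have h5' := (mul_eq_zero.1 ((mul_eq_zero.1 h5).resolve_left hwz)).resolve_left he0
      refine pow_ne_zero 2 he0 ?_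
      rw [he]
      linear_combination h5' - hH - (w ^ 2 + z ^ 2 - w * z + 3) * h3
    · have e10 := key ((hmul nd2 nd5).2 (iff_of_false n2 n5))
      have frob : ∀ v : K, (v + 1) ^ (2 * 5) - v ^ (2 * 5) = v ^ 9 + v + 1 := by
        intro v
        have : (v + 1) ^ 9 = v ^ 9 + 1 := by
          simpa using add_pow_char_pow v 1 (p := 3) (n := 2)
        linear_combination (v + 1) * this
      rw [frob, frob] at e10
      have h9 : (x - y) ^ 9 = x ^ 9 - y ^ 9 := sub_pow_char_pow x y (p := 3) (n := 2)
      have hd : (x - y) ^ 2 = -1 := by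
        rw [hw, hz] at hH
        linear_combination hH - ((x - y) ^ 2 + (2 * x + 1) * (2 * y + 1)) * h3
      have h8 : (x - y) ^ 9 = x - y := by
        linear_combination (x - y) * ((x - y) ^ 2 - 1) * ((x - y) ^ 4 + 1) * hd
      exact mul_ne_zero h2 hsub (by linear_combination e10 - h8 + h9)
  · by_cases hl3 : l = 3
    · subst hl3
      have : 3 * ((x - y) * (x + y + 1)) = 0 := by linear_combination hx - hy
      exact mul_ne_zero h3 (mul_ne_zero hsub hsum) this
    have nd3 := nd 3 Nat.prime_three hl3
    have n3 : ¬ ∃ k : ℕ, ((3 : ℕ) : ZMod l) = (p : ZMod l) ^ k := by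
      intro h
      have := key h
      have : 3 * ((x - y) * (x + y + 1)) = 0 := by linear_combination this
      exact mul_ne_zero h3 (mul_ne_zero hsub hsum) this
    have e6 := key ((hmul nd2 nd3).2 (iff_of_false n2 n3))
    have e9 := key ((hmul nd3 nd3).2 Iff.rfl)
    obtain ⟨H, hHdef⟩ : ∃ H, H = w ^ 2 + w * z + z ^ 2 := ⟨_, rfl⟩
    have q6 : (w - z) * (3 * (e ^ 2 * H - e ^ 4 + H ^ 2) + 10 * H + 3) = 0 := by
      rw [hHdef, he, hw, hz]; linear_combination 16 * e6
    have q9 : 3 * ((w - z) * (e * (3 * (e ^ 6 - 2 * e ^ 4 * H - 2 * e ^ 2 * H ^ 2 + 4 * H ^ 3)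
        + 28 * (3 * H ^ 2 - 2 * e ^ 2 * H) + 42 * (2 * H - e ^ 2) + 12))) = 0 := by
      rw [hHdef, he, hw, hz]; linear_combination 256 * e9
    replace q6 := (mul_eq_zero.1 q6).resolve_left hwz
    replace q9 := (mul_eq_zero.1 ((mul_eq_zero.1 ((mul_eq_zero.1 q9).resolve_left h3)).resolve_left
      hwz)).resolve_left he0
    rw [hHdef, hH] at q6 q9
    have q9' : e ^ 2 * (3 * e ^ 4 + 6 * e ^ 2 + 8) = 0 := by linear_combination q9
    replace q9' := (mul_eq_zero.1 q9').resolve_left (pow_ne_zero 2 he0)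
    have : 3 * e ^ 4 = 0 := by linear_combination -q9' - 2 * q6
    exact mul_ne_zero h3 (pow_ne_zero 4 he0) this
theorem homogeneousComponent_add_mul {σ R : Type*} [CommSemiring R] {m n : ℕ}
    {P Q : MvPolynomial σ R} (hP : P.totalDegree ≤ m) (hQ : Q.totalDegree ≤ n) :
    homogeneousComponent (m + n) (P * Q) =
      homogeneousComponent m P * homogeneousComponent n Q := by
  classical
  ext d
  rw [coeff_homogeneousComponent]
  split_ifs with hd
  · rw [coeff_mul, coeff_mul]
    refine Finset.sum_congr rfl fun c hc => ?_
    rw [Finset.HasAntidiagonal.mem_antidiagonal] at hc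
    have hdeg : c.1.degree + c.2.degree = m + n := by rw [← hd, ← hc, map_add]
    rw [coeff_homogeneousComponent, coeff_homogeneousComponent]
    rcases lt_trichotomy c.1.degree m with h | h | h
    · have : coeff c.2 Q = 0 := coeff_eq_zero_of_totalDegree_lt (by
        have : n < c.2.degree := by omega
        exact hQ.trans_lt this)
      simp [this]
    · rw [if_pos h, if_pos (by omega)]
    · have : coeff c.1 P = 0 := coeff_eq_zero_of_totalDegree_lt (by
        exact hP.trans_lt h)
      simp [this]
  · exact (((homogeneousComponent_isHomogeneous m P).mul
      (homogeneousComponent_isHomogeneous n Q)).coeff_eq_zero hd).symm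

theorem homogeneousComponent_totalDegree_ne_zero {σ R : Type*} [CommSemiring R]
    {P : MvPolynomial σ R} (hP : P ≠ 0) : homogeneousComponent P.totalDegree P ≠ 0 := by
  intro h
  obtain ⟨d, hd, hdeg⟩ := Finset.exists_mem_eq_sup P.support (support_nonempty.2 hP)
    fun s => s.sum fun _ e => e
  have h1 := congrArg (coeff d) h
  rw [coeff_homogeneousComponent, if_pos, coeff_zero] at h1
  · exact mem_support_iff.1 hd h1
  · exact hdeg.symm

theorem totalDegree_lt_of_homogeneousComponent_eq_zero {σ R : Type*} [CommSemiring R] {n : ℕ}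
    {P : MvPolynomial σ R} (hn : 0 < n) (hP : P.totalDegree ≤ n)
    (h : homogeneousComponent n P = 0) : P.totalDegree < n := by
  refine lt_of_le_of_ne hP fun he => ?_
  have hP0 : P ≠ 0 := by
    rintro rfl
    rw [totalDegree_zero] at he
    omega
  rw [← he] at h
  exact homogeneousComponent_totalDegree_ne_zero hP0 h

/-- Two nonconstant polynomials whose leading forms have no common factor do not generate the
unit ideal. -/
theorem mul_add_mul_ne_one {σ K : Type*} [Field K] {A B : MvPolynomial σ K}
    (hA : 0 < A.totalDegree) (hB : 0 < B.totalDegree)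
    (hrel : IsRelPrime (homogeneousComponent A.totalDegree A)
      (homogeneousComponent B.totalDegree B)) (U V : MvPolynomial σ K) :
    A * U + B * V ≠ 1 := by
  have hA0 : A ≠ 0 := by rintro rfl; simp at hA
  have hB0 : B ≠ 0 := by rintro rfl; simp at hB
  have hb0 := homogeneousComponent_totalDegree_ne_zero hB0
  induction hn : U.totalDegree using Nat.strong_induction_on generalizing U V with
  | _ n ih =>
  intro h
  by_cases hU0 : U = 0
  · rw [hU0, mul_zero, zero_add] at h
    have := (isUnit_iff_totalDegree_of_isReduced.1 (IsUnit.of_mul_eq_one V h)).2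
    omega
  have hV0 : V ≠ 0 := by
    rintro rfl
    rw [mul_zero, add_zero] at h
    have := (isUnit_iff_totalDegree_of_isReduced.1 (IsUnit.of_mul_eq_one U h)).2
    omega
  have hdeg : B.totalDegree + V.totalDegree = A.totalDegree + U.totalDegree := by
    rw [← totalDegree_mul_of_isDomain hB0 hV0, ← totalDegree_mul_of_isDomain hA0 hU0,
      eq_sub_of_add_eq' h]
    have hAU : 0 < (A * U).totalDegree := by
      rw [totalDegree_mul_of_isDomain hA0 hU0]; omega
    rw [sub_eq_neg_add, totalDegree_add_eq_left_of_totalDegree_lt, totalDegree_neg]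
    rwa [totalDegree_neg, totalDegree_one]
  have htop : homogeneousComponent A.totalDegree A * homogeneousComponent U.totalDegree U +
      homogeneousComponent B.totalDegree B * homogeneousComponent V.totalDegree V = 0 := by
    rw [← homogeneousComponent_add_mul le_rfl le_rfl, ← homogeneousComponent_add_mul le_rfl le_rfl,
      hdeg, ← map_add, h]
    exact homogeneousComponent_eq_zero _ _ (by rw [totalDegree_one]; omega)
  obtain ⟨c, hc⟩ : homogeneousComponent B.totalDegree B ∣
      homogeneousComponent U.totalDegree U :=
    hrel.symm.dvd_of_dvd_mul_left ⟨-homogeneousComponent V.totalDegree V, by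
      linear_combination htop⟩
  have hu0 := homogeneousComponent_totalDegree_ne_zero hU0
  have hc0 : c ≠ 0 := by rintro rfl; exact hu0 (by rw [hc, mul_zero])
  have hcdeg : B.totalDegree + c.totalDegree = U.totalDegree := by
    rw [← (homogeneousComponent_isHomogeneous _ B).totalDegree hb0,
      ← totalDegree_mul_of_isDomain hb0 hc0, ← hc,
      (homogeneousComponent_isHomogeneous _ U).totalDegree hu0]
  have hlt : (U - B * c).totalDegree < U.totalDegree := by
    refine totalDegree_lt_of_homogeneousComponent_eq_zero (by omega) ?_ ?_
    · refine (totalDegree_sub _ _).trans (max_le le_rfl ?_)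
      rw [totalDegree_mul_of_isDomain hB0 hc0, hcdeg]
    · have hbc : homogeneousComponent B.totalDegree B * homogeneousComponent c.totalDegree c =
          homogeneousComponent U.totalDegree U := by
        have h1 := homogeneousComponent_isHomogeneous B.totalDegree B
        have h2 := homogeneousComponent_add_mul h1.totalDegree_le (le_refl c.totalDegree)
        rw [homogeneousComponent_eq_self h1, ← hc, hcdeg,
          homogeneousComponent_eq_self (homogeneousComponent_isHomogeneous _ U)] at h2
        exact h2.symm
      have h3 := homogeneousComponent_add_mul (le_refl B.totalDegree) (le_refl c.totalDegree)
      rw [hbc, hcdeg] at h3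
      rw [map_sub, h3, sub_self]
  refine ih _ (hn ▸ hlt) (U - B * c) (V + A * c) rfl ?_
  rw [← h]; ring

/-- A weak form of Bézout's theorem. -/
theorem exists_common_zero {σ K : Type*} [Finite σ] [Field K] [IsAlgClosed K]
    {A B : MvPolynomial σ K} (hA : 0 < A.totalDegree) (hB : 0 < B.totalDegree)
    (hrel : IsRelPrime (homogeneousComponent A.totalDegree A)
      (homogeneousComponent B.totalDegree B)) :
    ∃ v : σ → K, eval v A = 0 ∧ eval v B = 0 := by
  by_contra! hno
  have hempty : zeroLocus K (Ideal.span {A, B}) = ∅ := by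
    rw [zeroLocus_span, Set.eq_empty_iff_forall_notMem]
    intro v hv
    exact hno v (by simpa [aeval_eq_eval] using hv A (by simp))
      (by simpa [aeval_eq_eval] using hv B (by simp))
  have htop := vanishingIdeal_zeroLocus_eq_radical (K := K) (Ideal.span {A, B})
  rw [hempty, vanishingIdeal_empty, eq_comm, Ideal.radical_eq_top, Ideal.eq_top_iff_one,
    Ideal.mem_span_pair] at htop
  obtain ⟨U, V, h⟩ := htop
  exact mul_add_mul_ne_one hA hB hrel U V (by rw [← h]; ring)

theorem exists_add_one_pow_eq {σ R : Type*} [CommSemiring R] (i : σ) (n : ℕ) :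
    ∃ r : MvPolynomial σ R, (X i + 1) ^ (n + 2) =
      X i ^ (n + 2) + C ((n + 2 : ℕ) : R) * X i ^ (n + 1) + r ∧ r.totalDegree ≤ n := by
  have hX : ∀ k : ℕ, (X i ^ k : MvPolynomial σ R).totalDegree ≤ k := fun k =>
    (isHomogeneous_X_pow i k).totalDegree_le
  induction n with
  | zero => exact ⟨1, by rw [map_natCast]; push_cast; ring, by simp⟩
  | succ n ih =>
    obtain ⟨r, hr, hdeg⟩ := ih
    refine ⟨C ((n + 2 : ℕ) : R) * X i ^ (n + 1) + r * (X i + 1), ?_, ?_⟩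
    · rw [pow_succ, hr]
      simp only [map_natCast]
      push_cast
      ring
    · refine (totalDegree_add _ _).trans (max_le ?_ ?_)
      · refine (totalDegree_mul _ _).trans ?_
        rw [totalDegree_C, zero_add]
        exact hX _
      · refine (totalDegree_mul _ _).trans (add_le_add hdeg ?_)
        refine (totalDegree_add _ _).trans (max_le ?_ (by simp))
        simpa using hX 1

theorem exists_add_one_pow_sub_eq {R : Type*} [CommRing R] (n : ℕ) :
    ∃ r : MvPolynomial (Fin 2) R, (X 0 + 1) ^ (n + 2) - X 0 ^ (n + 2) - (X 1 + 1) ^ (n + 2) +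
      X 1 ^ (n + 2) = C ((n + 2 : ℕ) : R) * (X 0 ^ (n + 1) - X 1 ^ (n + 1)) + r ∧
      r.totalDegree ≤ n := by
  obtain ⟨r, hr, hrdeg⟩ := exists_add_one_pow_eq (R := R) (0 : Fin 2) n
  obtain ⟨s, hs, hsdeg⟩ := exists_add_one_pow_eq (R := R) (1 : Fin 2) n
  exact ⟨r - s, by rw [hr, hs]; ring, (totalDegree_sub _ _).trans (max_le hrdeg hsdeg)⟩

theorem isRelPrime_of_mul_mul_eq {K : Type*} [Field K] {n : ℕ} (hn : (n : K) ≠ 0) {c : K}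
    (hc : c ≠ 0) {a b e : MvPolynomial (Fin 2) K}
    (h : e * (a * b) = C c * (X 0 ^ n - X 1 ^ n)) : IsRelPrime a b := by
  intro d hda hdb
  have hderiv : ∀ i : Fin 2, d ∣ pderiv i (e * (a * b)) := by
    obtain ⟨a', rfl⟩ := hda
    obtain ⟨b', rfl⟩ := hdb
    intro i
    simp only [pderiv_mul]
    refine ⟨pderiv i e * (a' * (d * b')) + e * ((pderiv i d * a' + d * pderiv i a') * b' +
      a' * (pderiv i d * b' + d * pderiv i b')), by ring⟩
  have hX : ∀ i : Fin 2, d ∣ X i ^ (n - 1) := by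
    intro i
    have h1 := hderiv i
    rw [h, pderiv_C_mul, map_sub, pderiv_pow, pderiv_pow] at h1
    have hu : IsUnit (C (c * n) : MvPolynomial (Fin 2) K) :=
      (isUnit_iff_ne_zero.2 (mul_ne_zero hc hn)).map C
    fin_cases i
    · rw [← hu.dvd_mul_left]
      simpa [pderiv_X_of_ne, mul_assoc] using h1
    · rw [← hu.dvd_mul_left]
      simpa [pderiv_X_of_ne, mul_assoc] using h1
  have hrel : IsRelPrime (X 0 : MvPolynomial (Fin 2) K) (X 1) := by
    rw [(X_prime (i := 0)).irreducible.isRelPrime_iff_not_dvd, X_dvd_X]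
    simp
  exact hrel.pow (hX 0) (hX 1)

/-- A common zero of two factors of `g` is a singular point of `g`, so its coordinates are distinct
critical points of `(X + 1) ^ (n + 2) - X ^ (n + 2)` with equal critical values. -/
theorem singular_point_of_mul_eq {K : Type*} [Field K] {n : ℕ} (hn2 : ((n + 2 : ℕ) : K) ≠ 0)
    (hn1 : ((n + 1 : ℕ) : K) ≠ 0) {A B : MvPolynomial (Fin 2) K}
    (h : (X 0 + 1) ^ (n + 2) - X 0 ^ (n + 2) - (X 1 + 1) ^ (n + 2) + X 1 ^ (n + 2) =
      (X 0 - X 1) * (A * B)) {v : Fin 2 → K} (hA : eval v A = 0) (hB : eval v B = 0) :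
    (v 0 + 1) ^ (n + 1) = v 0 ^ (n + 1) ∧ (v 1 + 1) ^ (n + 1) = v 1 ^ (n + 1) ∧
      v 0 ^ (n + 1) = v 1 ^ (n + 1) ∧ v 0 ≠ 0 ∧ v 1 ≠ 0 ∧ v 0 ≠ v 1 := by
  have hp0 := congrArg (pderiv 0) h
  have hp1 := congrArg (pderiv 1) h
  simp only [map_add, map_sub, pderiv_mul, pderiv_pow, pderiv_one, pderiv_X_self,
    pderiv_X_of_ne (zero_ne_one (α := Fin 2)), pderiv_X_of_ne (one_ne_zero (α := Fin 2))] at hp0 hp1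
  have hp00 := congrArg (pderiv 0) hp0
  simp at hp00
  have hder : pderiv 0 (2 : MvPolynomial (Fin 2) K) = 0 := by
    simpa using (pderiv (0 : Fin 2)).map_natCast (A := MvPolynomial (Fin 2) K) 2
  have e := congrArg (eval v) h
  have e0 := congrArg (eval v) hp0
  have e1 := congrArg (eval v) hp1
  have e00 := congrArg (eval v) hp00
  simp [hA, hB, hder] at e e0 e1 e00
  push_cast at hn1 hn2
  have h0 : (v 0 + 1) ^ (n + 1) = v 0 ^ (n + 1) :=
    mul_left_cancel₀ hn2 (by linear_combination e0)
  have h1 : (v 1 + 1) ^ (n + 1) = v 1 ^ (n + 1) :=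
    mul_left_cancel₀ hn2 (by linear_combination -e1)
  have hv0 : v 0 ≠ 0 := fun hz => by simp [hz] at h0
  have hv1 : v 1 ≠ 0 := fun hz => by simp [hz] at h1
  refine ⟨h0, h1, by linear_combination e - (v 0 + 1) * h0 + (v 1 + 1) * h1, hv0, hv1,
    fun heq => ?_⟩
  rw [heq, sub_self, zero_mul, ← heq] at e00
  have h2 : (v 0 + 1) ^ n = v 0 ^ n :=
    mul_left_cancel₀ (mul_ne_zero hn2 hn1) (by linear_combination e00)
  refine pow_ne_zero n hv0 ?_
  linear_combination h0 - (v 0 + 1) * h2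

/-- Case (A), condition (e): if `t-1 ≥ 3` is prime and the multiplicative order
of `p` in `Z/(t-1)Z` is `(t-2)/2`, then `g_t` has an absolutely irreducible
factor over `F_p`. -/
theorem gt_has_abs_irred_factor_of_prime_order
    (p t : ℕ) [Fact p.Prime] (hp2 : p ≠ 2) (ht : 3 ≤ t) (hpt : ¬ p ∣ t)
    (g : MvPolynomial (Fin 2) (ZMod p))
    (hg : ((X 0 + 1) ^ t - X 0 ^ t - (X 1 + 1) ^ t + X 1 ^ t : MvPolynomial (Fin 2) (ZMod p))
        = (X 0 - X 1) * g)
    (hte : Even t) (h0 : t % p ≠ 0) (h1 : t % p ≠ 1)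
    (ht1 : 3 ≤ t - 1) (htp : (t - 1).Prime)
    (hord : orderOf ((p : ZMod (t - 1))) = (t - 2) / 2) :
    ∃ h : MvPolynomial (Fin 2) (ZMod p), 0 < h.totalDegree ∧ h ∣ g ∧
      Irreducible (MvPolynomial.map (algebraMap (ZMod p) (AlgebraicClosure (ZMod p))) h) := by
  obtain ⟨n, rfl⟩ : ∃ n, t = n + 2 := ⟨t - 2, by omega⟩
  have hsub : n + 2 - 1 = n + 1 := rfl
  rw [hsub] at ht1 htp hord
  rw [show n + 2 - 2 = n + 1 - 1 from rfl] at hord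
  have hpp : p.Prime := Fact.out
  have : Fact (n + 1).Prime := ⟨htp⟩
  set K := AlgebraicClosure (ZMod p)
  have : CharP K p := charP_of_injective_algebraMap (algebraMap (ZMod p) K).injective p
  set G : MvPolynomial (Fin 2) K := MvPolynomial.map (algebraMap (ZMod p) K) g
  have hG : ((X 0 + 1) ^ (n + 2) - X 0 ^ (n + 2) - (X 1 + 1) ^ (n + 2) + X 1 ^ (n + 2) :
      MvPolynomial (Fin 2) K) = (X 0 - X 1) * G := by
    have := congrArg (MvPolynomial.map (algebraMap (ZMod p) K)) hg
    simpa using this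
  have hc1 : ((n + 2 : ℕ) : K) ≠ 0 := by rwa [Ne, CharP.cast_eq_zero_iff K p]
  have hc2 : ((n + 1 : ℕ) : K) ≠ 0 := by
    rw [Ne, CharP.cast_eq_zero_iff K p, Nat.prime_dvd_prime_iff_eq hpp htp]
    rintro rfl
    rw [CharP.cast_eq_zero, orderOf_zero] at hord
    omega
  obtain ⟨r, hr, hrdeg⟩ := exists_add_one_pow_sub_eq (R := K) n
  have hcomp : homogeneousComponent (n + 1) ((X 0 - X 1) * G) =
      C ((n + 2 : ℕ) : K) * (X 0 ^ (n + 1) - X 1 ^ (n + 1)) := by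
    rw [← hG, hr, map_add, homogeneousComponent_C_mul, map_sub,
      homogeneousComponent_eq_self (isHomogeneous_X_pow _ _),
      homogeneousComponent_eq_self (isHomogeneous_X_pow _ _),
      homogeneousComponent_eq_zero _ r (by omega), add_zero]
  have hdegle : ((X 0 - X 1) * G).totalDegree ≤ n + 1 := by
    rw [← hG, hr]
    refine (totalDegree_add _ _).trans (max_le ?_ (by omega))
    refine (totalDegree_mul _ _).trans ?_
    rw [totalDegree_C, zero_add]
    exact (totalDegree_sub _ _).trans (max_le (isHomogeneous_X_pow _ _).totalDegree_le
      (isHomogeneous_X_pow _ _).totalDegree_le)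
  have hcompne : (C ((n + 2 : ℕ) : K) * (X 0 ^ (n + 1) - X 1 ^ (n + 1)) :
      MvPolynomial (Fin 2) K) ≠ 0 := by
    intro h
    have := congrArg (eval ![1, 0]) h
    simp at this
    exact hc1 (by push_cast; exact this)
  have hdegge : n + 1 ≤ ((X 0 - X 1) * G).totalDegree := by
    by_contra! h
    exact hcompne (hcomp ▸ homogeneousComponent_eq_zero _ _ h)
  have hprod : (X 0 - X 1) * G ≠ 0 := fun h => by
    rw [h, map_zero] at hcomp
    exact hcompne hcomp.symm
  have hlin : (X 0 - X 1 : MvPolynomial (Fin 2) K).IsHomogeneous 1 :=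
    (isHomogeneous_X _ _).sub (isHomogeneous_X _ _)
  have hGdeg : G.totalDegree = n := by
    have := totalDegree_mul_of_isDomain (left_ne_zero_of_mul hprod) (right_ne_zero_of_mul hprod)
    rw [hlin.totalDegree (left_ne_zero_of_mul hprod)] at this
    omega
  have hGtop : (X 0 - X 1) * homogeneousComponent G.totalDegree G =
      C ((n + 2 : ℕ) : K) * (X 0 ^ (n + 1) - X 1 ^ (n + 1)) := by
    rw [← hcomp, ← homogeneousComponent_eq_self hlin,
      ← homogeneousComponent_add_mul hlin.totalDegree_le le_rfl, hGdeg, add_comm 1 n,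
      homogeneousComponent_eq_self hlin]
  refine ⟨g, ?_, dvd_rfl, ?_⟩
  · have : G.totalDegree ≤ g.totalDegree :=
      Finset.sup_mono (support_map_subset _ _)
    omega
  rw [irreducible_iff]
  refine ⟨fun h => ?_, fun {A B} hAB => ?_⟩
  · have : G.totalDegree = 0 := (isUnit_iff_totalDegree_of_isReduced.1 h).2
    omega
  change G = A * B at hAB
  by_contra! hnu
  have hG0 := right_ne_zero_of_mul hprod
  rw [hAB] at hG0
  have hA0 := left_ne_zero_of_mul hG0
  have hB0 := right_ne_zero_of_mul hG0
  have hpos : ∀ P : MvPolynomial (Fin 2) K, P ≠ 0 → ¬ IsUnit P → 0 < P.totalDegree := by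
    intro P hP0 hP
    refine Nat.pos_of_ne_zero fun h => hP ?_
    rw [totalDegree_eq_zero_iff_eq_C] at h
    rw [h] at hP0 ⊢
    exact (isUnit_iff_ne_zero.2 fun hz => hP0 (by rw [hz, map_zero])).map C
  have hrel : IsRelPrime (homogeneousComponent A.totalDegree A)
      (homogeneousComponent B.totalDegree B) := by
    refine isRelPrime_of_mul_mul_eq hc2 hc1 (e := X 0 - X 1) ?_
    rw [← homogeneousComponent_add_mul le_rfl le_rfl, ← totalDegree_mul_of_isDomain hA0 hB0,
      ← hAB, hGtop]
  obtain ⟨v, hvA, hvB⟩ := exists_common_zero (hpos A hA0 hnu.1) (hpos B hB0 hnu.2) hrel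
  obtain ⟨hx, hy, hxy, hx0, hy0, hne⟩ := singular_point_of_mul_eq hc1 hc2 (hAB ▸ hG) hvA hvB
  exact hne (eq_of_critical_values_eq hp2 ht1 hord hx0 hy0 hx hy hxy)
end
end

section
/- Assume t is even and t is congruent to neither 0 nor 1 modulo p. For n coprime to p let e_n denote the multiplicative order of p modulo n, and set e := gcd(e_{t−1}, e_t). If either (1) there exists a divisor d > 2 of t with gcd(e, e_d) = 1, or (2) there exists a divisor d > 1 of t − 1 with gcd(e, e_d) = 1, then g_t(x,y) has an absolutely irreducible factor in F_p[x,y]. -/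
open MvPolynomial

noncomputable section

theorem exists_irreducible_dvd_map_eq_zero {A M : Type*} [CommRing A] [IsDomain A]
    [WfDvdMonoid A] [MonoidWithZero M] [NoZeroDivisors M] [Nontrivial M] (χ : A →* M) {G : A}
    (hG : G ≠ 0) (h0 : χ G = 0) : ∃ h, Irreducible h ∧ h ∣ G ∧ χ h = 0 := by
  induction G using WfDvdMonoid.induction_on_irreducible with
  | zero => exact absurd rfl hG
  | unit u hu => exact absurd h0 (hu.map χ).ne_zero
  | mul a i ha hi ih =>
    rw [map_mul, mul_eq_zero] at h0
    rcases h0 with h0 | h0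
    · exact ⟨i, hi, dvd_mul_right _ _, h0⟩
    · obtain ⟨h, h1, h2, h3⟩ := ih ha h0
      exact ⟨h, h1, h2.mul_left i, h3⟩

theorem associated_map_of_isRoot {A K : Type*} [CommRing A] [IsDomain A]
    [UniqueFactorizationMonoid A] [Field K] (φ : A →* Polynomial K) (τ : A ≃+* A) (θ : K →+* K)
    (hφ : ∀ q, φ (τ q) = (φ q).map θ) {G h : A} (hsq : Squarefree (φ G)) (hτ : τ G = G)
    (hh : Irreducible h) (hd : h ∣ G) {a : K} (ha : (φ h).IsRoot a) (hθ : θ a = a) :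
    Associated (τ h) h := by
  have hτh : Irreducible (τ h) := (MulEquiv.irreducible_iff τ).2 hh
  have hτd : τ h ∣ G := hτ ▸ map_dvd τ hd
  by_contra hna
  obtain ⟨k, rfl⟩ := hd
  have h2 : τ h ∣ k :=
    (hτh.prime.dvd_or_dvd hτd).resolve_left fun h => hna (hτh.associated_of_dvd hh h)
  have hroot : (φ (τ h)).IsRoot a := by
    rw [hφ]
    simpa [hθ] using ha.map (f := θ)
  have h3 : (Polynomial.X - Polynomial.C a) * (Polynomial.X - Polynomial.C a) ∣ φ (h * k) := by
    rw [map_mul]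
    exact mul_dvd_mul (Polynomial.dvd_iff_isRoot.2 ha)
      ((Polynomial.dvd_iff_isRoot.2 hroot).trans (map_dvd φ h2))
  exact Polynomial.not_isUnit_X_sub_C a (hsq _ h3)

section Field

variable {K : Type*} [Field K]

theorem natDegree_map_eq_totalDegree_of_dvd {σ : Type*} (φ : MvPolynomial σ K →* Polynomial K)
    (hφ : ∀ q, (φ q).natDegree ≤ q.totalDegree) {G h : MvPolynomial σ K} (h0 : φ G ≠ 0)
    (hG0 : G ≠ 0) (hG : G.totalDegree ≤ (φ G).natDegree) (hd : h ∣ G) :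
    (φ h).natDegree = h.totalDegree := by
  obtain ⟨k, rfl⟩ := hd
  rw [map_mul] at h0 hG
  rw [totalDegree_mul_of_isDomain (left_ne_zero_of_mul hG0) (right_ne_zero_of_mul hG0),
    Polynomial.natDegree_mul (left_ne_zero_of_mul h0) (right_ne_zero_of_mul h0)] at hG
  have := hφ h
  have := hφ k
  omega

theorem Irreducible.totalDegree_pos {σ : Type*} {h : MvPolynomial σ K} (hh : Irreducible h) :
    0 < h.totalDegree := by
  rw [Nat.pos_iff_ne_zero]
  intro h0
  rw [totalDegree_eq_zero_iff_eq_C] at h0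
  rw [h0] at hh
  refine hh.not_isUnit (IsUnit.map C (isUnit_iff_ne_zero.2 fun hc => hh.ne_zero ?_))
  rw [hc, C_0]

theorem exists_isRoot_map_of_dvd [IsAlgClosed K] {σ : Type*}
    (φ : MvPolynomial σ K →* Polynomial K)
    (hφ : ∀ q, (φ q).natDegree ≤ q.totalDegree) {G h : MvPolynomial σ K} (h0 : φ G ≠ 0)
    (hG0 : G ≠ 0) (hG : G.totalDegree ≤ (φ G).natDegree) (hd : h ∣ G) (hh : Irreducible h) :
    ∃ a, (φ h).IsRoot a := by
  refine IsAlgClosed.exists_root _ fun hdeg => ?_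
  have h1 := natDegree_map_eq_totalDegree_of_dvd φ hφ h0 hG0 hG hd
  rw [Polynomial.natDegree_eq_of_degree_eq_some hdeg] at h1
  exact hh.totalDegree_pos.ne h1

/-- Restriction of a bivariate polynomial to the line `y = b`. -/
def restrictLine (b : K) : MvPolynomial (Fin 2) K →ₐ[K] Polynomial K :=
  aeval ![Polynomial.X, Polynomial.C b]

/-- The substitution `(x, y) ↦ (x s, s)`, whose result is graded by the degree in `s`. -/
def gradeHom (K : Type*) [Field K] : MvPolynomial (Fin 2) K →+* Polynomial (Polynomial K) :=
  eval₂Hom (Polynomial.C.comp Polynomial.C)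
    ![Polynomial.C Polynomial.X * Polynomial.X, Polynomial.X]

/-- The leading form of a bivariate polynomial, dehomogenized at `y = 1`. -/
def leadingForm (K : Type*) [Field K] : MvPolynomial (Fin 2) K →* Polynomial K :=
  (Polynomial.leadingCoeffHom : Polynomial (Polynomial K) →* Polynomial K).comp
    (gradeHom K : MvPolynomial (Fin 2) K →* Polynomial (Polynomial K))

theorem leadingForm_apply (q : MvPolynomial (Fin 2) K) :
    leadingForm K q = (gradeHom K q).leadingCoeff := rfl

theorem natDegree_restrictLine_le (b : K) (q : MvPolynomial (Fin 2) K) :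
    (restrictLine b q).natDegree ≤ q.totalDegree := by
  rw [← mul_one q.totalDegree]
  refine MvPolynomial.aeval_natDegree_le q le_rfl _ fun i => ?_
  fin_cases i <;> simp

theorem natDegree_gradeHom_le (q : MvPolynomial (Fin 2) K) :
    (gradeHom K q).natDegree ≤ q.totalDegree := by
  have h : gradeHom K q = aeval ![Polynomial.C Polynomial.X * Polynomial.X, Polynomial.X]
      (map (Polynomial.C : K →+* Polynomial K) q) := by
    rw [aeval_def, eval₂_map]
    rfl
  rw [h, ← mul_one q.totalDegree]
  refine MvPolynomial.aeval_natDegree_le _ (Finset.sup_mono (support_map_subset _ _)) _ fun i => ?_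
  fin_cases i
  · exact (Polynomial.natDegree_C_mul_le _ _).trans Polynomial.natDegree_X_le
  · exact Polynomial.natDegree_X_le

theorem natDegree_coeff_gradeHom_le (q : MvPolynomial (Fin 2) K) (k : ℕ) :
    ((gradeHom K q).coeff k).natDegree ≤ k := by
  induction q using MvPolynomial.induction_on generalizing k with
  | C a =>
    simp only [gradeHom, coe_eval₂Hom, eval₂_C, RingHom.comp_apply, Polynomial.coeff_C]
    split_ifs <;> simp
  | add q r hq hr =>
    rw [map_add, Polynomial.coeff_add]
    exact (Polynomial.natDegree_add_le _ _).trans (max_le (hq k) (hr k))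
  | mul_X q i hq =>
    rw [map_mul]
    cases k with
    | zero => fin_cases i <;> simp [gradeHom]
    | succ k =>
      fin_cases i
      · have : gradeHom K (X 0) = Polynomial.C Polynomial.X * Polynomial.X := by simp [gradeHom]
        simp only [Fin.zero_eta, this, ← mul_assoc, Polynomial.coeff_mul_X,
          Polynomial.coeff_mul_C]
        exact (Polynomial.natDegree_mul_le).trans
          (add_le_add (hq k) Polynomial.natDegree_X_le)
      · have : gradeHom K (X 1) = Polynomial.X := by simp [gradeHom]
        simp only [Fin.mk_one, this, Polynomial.coeff_mul_X]
        exact (hq k).trans k.le_succ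

theorem natDegree_leadingForm_le (q : MvPolynomial (Fin 2) K) :
    (leadingForm K q).natDegree ≤ q.totalDegree :=
  (natDegree_coeff_gradeHom_le q _).trans (natDegree_gradeHom_le q)

theorem restrictLine_map (θ : K →+* K) {b : K} (hb : θ b = b) (q : MvPolynomial (Fin 2) K) :
    restrictLine b (map θ q) = (restrictLine b q).map θ := by
  suffices h : (restrictLine b : MvPolynomial (Fin 2) K →+* Polynomial K).comp (map θ) =
      (Polynomial.mapRingHom θ).comp (restrictLine b : MvPolynomial (Fin 2) K →+* Polynomial K) from
    RingHom.congr_fun h q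
  refine MvPolynomial.ringHom_ext (fun r => ?_) fun i => ?_
  · simp [restrictLine]
  · fin_cases i <;> simp [restrictLine, hb]

theorem leadingForm_map (θ : K →+* K) (q : MvPolynomial (Fin 2) K) :
    leadingForm K (map θ q) = (leadingForm K q).map θ := by
  have h : (gradeHom K).comp (map θ) =
      (Polynomial.mapRingHom (Polynomial.mapRingHom θ)).comp (gradeHom K) := by
    refine MvPolynomial.ringHom_ext (fun r => ?_) fun i => ?_
    · simp [gradeHom]
    · fin_cases i <;> simp [gradeHom]
  have h' : gradeHom K (map θ q) = (gradeHom K q).map (Polynomial.mapRingHom θ) :=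
    RingHom.congr_fun h q
  rw [leadingForm_apply, h', leadingForm_apply, Polynomial.leadingCoeff_map_of_injective]
  · rfl
  · exact Polynomial.map_injective θ θ.injective

theorem coeff_X_add_one_pow_sub_X_pow {R : Type*} [CommRing R] (t n : ℕ) :
    ((Polynomial.X + 1) ^ t - Polynomial.X ^ t : Polynomial R).coeff n =
      if n = t then 0 else (t.choose n : R) := by
  rw [Polynomial.coeff_sub, Polynomial.coeff_X_add_one_pow, Polynomial.coeff_X_pow]
  split_ifs with h <;> simp [h]

theorem natDegree_X_add_one_pow_sub_X_pow_le {R : Type*} [CommRing R] (t : ℕ) :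
    ((Polynomial.X + 1) ^ t - Polynomial.X ^ t : Polynomial R).natDegree ≤ t - 1 := by
  rw [Polynomial.natDegree_le_iff_coeff_eq_zero]
  intro n hn
  rw [coeff_X_add_one_pow_sub_X_pow]
  split_ifs with h
  · rfl
  · rw [Nat.choose_eq_zero_of_lt (by omega), Nat.cast_zero]

theorem natDegree_X_add_one_pow_sub_X_pow {t : ℕ} (ht : (t : K) ≠ 0) :
    ((Polynomial.X + 1) ^ t - Polynomial.X ^ t : Polynomial K).natDegree = t - 1 := by
  have ht0 : t ≠ 0 := by rintro rfl; simp at ht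
  refine Polynomial.natDegree_eq_of_le_of_coeff_ne_zero
    (natDegree_X_add_one_pow_sub_X_pow_le t) ?_
  rw [coeff_X_add_one_pow_sub_X_pow, if_neg (by omega), Nat.choose_symm (by omega),
    Nat.choose_one_right]
  exact ht

theorem separable_X_add_one_pow_sub_X_pow {t : ℕ} (ht : (t : K) ≠ 0) :
    ((Polynomial.X + 1) ^ t - Polynomial.X ^ t : Polynomial K).Separable := by
  obtain ⟨n, rfl⟩ : ∃ n, t = n + 1 :=
    Nat.exists_eq_succ_of_ne_zero (by rintro rfl; simp at ht)
  have hco : IsCoprime (Polynomial.X : Polynomial K) (Polynomial.X + 1) := ⟨-1, 1, by ring⟩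
  obtain ⟨u, v, huv⟩ := hco.pow (m := n) (n := n)
  have hc : Polynomial.C ((n + 1 : ℕ) : K)⁻¹ * Polynomial.C ((n + 1 : ℕ) : K) = 1 := by
    rw [← Polynomial.C_mul, inv_mul_cancel₀ ht, Polynomial.C_1]
  refine ⟨u + v, -(u * (Polynomial.X + 1) + v * Polynomial.X) *
    Polynomial.C ((n + 1 : ℕ) : K)⁻¹, ?_⟩
  simp only [Polynomial.derivative_sub, Polynomial.derivative_pow, Polynomial.derivative_add,
    Polynomial.derivative_X, Polynomial.derivative_one, add_tsub_cancel_right, add_zero, mul_one,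
    Nat.cast_add, Nat.cast_one] at hc ⊢
  linear_combination huv - (u * (Polynomial.X + 1) + v * Polynomial.X) *
    ((Polynomial.X + 1) ^ n - Polynomial.X ^ n) * hc

/-- The polynomial `(x+1)^t - x^t - (y+1)^t + y^t`. -/
def differencePoly (R : Type*) [CommRing R] (t : ℕ) : MvPolynomial (Fin 2) R :=
  (X 0 + 1) ^ t - X 0 ^ t - (X 1 + 1) ^ t + X 1 ^ t

theorem totalDegree_differencePoly_le (t : ℕ) :
    (differencePoly K t).totalDegree ≤ t - 1 := by
  have key : ∀ i : Fin 2, ((X i + 1) ^ t - X i ^ t : MvPolynomial (Fin 2) K).totalDegree ≤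
      t - 1 := by
    intro i
    have : ((X i + 1) ^ t - X i ^ t : MvPolynomial (Fin 2) K) =
        Polynomial.aeval (X i) ((Polynomial.X + 1) ^ t - Polynomial.X ^ t : Polynomial K) := by
      simp
    rw [this, Polynomial.aeval_eq_sum_range]
    refine totalDegree_finsetSum_le fun n hn => ?_
    refine (totalDegree_smul_le _ _).trans ((totalDegree_pow _ _).trans ?_)
    rw [totalDegree_X, mul_one]
    exact (Finset.mem_range_succ_iff.1 hn).trans (natDegree_X_add_one_pow_sub_X_pow_le t)
  have : differencePoly K t = ((X 0 + 1) ^ t - X 0 ^ t) - ((X 1 + 1) ^ t - X 1 ^ t) := by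
    rw [differencePoly]; ring
  rw [this]
  exact (totalDegree_sub _ _).trans (max_le (key 0) (key 1))

theorem restrictLine_differencePoly (t : ℕ) {b : K} (hb : (b + 1) ^ t = b ^ t) :
    restrictLine b (differencePoly K t) = (Polynomial.X + 1) ^ t - Polynomial.X ^ t := by
  have : (Polynomial.C b + 1) ^ t = (Polynomial.C b) ^ t := by
    rw [← Polynomial.C_pow, ← hb]; simp
  simp [differencePoly, restrictLine, this]

theorem leadingForm_differencePoly {t : ℕ} (ht : (t : K) ≠ 0) (ht2 : 2 ≤ t) :
    leadingForm K (differencePoly K t) =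
      Polynomial.C (t : K) * (Polynomial.X ^ (t - 1) - 1) := by
  set F : Polynomial (Polynomial K) := (Polynomial.X + 1) ^ t - Polynomial.X ^ t with hF
  have h1 : gradeHom K (differencePoly K t) =
      F.comp (Polynomial.C Polynomial.X * Polynomial.X) - F := by
    simp [differencePoly, gradeHom, hF]
    ring
  have h2 : ∀ n, (gradeHom K (differencePoly K t)).coeff n =
      F.coeff n * (Polynomial.X ^ n - 1) := by
    intro n
    rw [h1, Polynomial.coeff_sub, Polynomial.comp_C_mul_X_coeff]
    ring
  have h3 : (gradeHom K (differencePoly K t)).coeff (t - 1) =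
      Polynomial.C (t : K) * (Polynomial.X ^ (t - 1) - 1) := by
    rw [h2, hF, coeff_X_add_one_pow_sub_X_pow, if_neg (by omega), Nat.choose_symm (by omega),
      Nat.choose_one_right, map_natCast]
  have h4 : Polynomial.C (t : K) * (Polynomial.X ^ (t - 1) - 1) ≠ 0 :=
    mul_ne_zero (Polynomial.C_ne_zero.2 ht)
      (Polynomial.X_pow_sub_C_ne_zero (by omega) 1)
  have h5 : (gradeHom K (differencePoly K t)).natDegree = t - 1 :=
    Polynomial.natDegree_eq_of_le_of_coeff_ne_zero
      ((natDegree_gradeHom_le _).trans (totalDegree_differencePoly_le t)) (h3 ▸ h4)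
  rw [leadingForm_apply, Polynomial.leadingCoeff, h5, h3]

theorem leadingForm_X_sub_X : leadingForm K (X 0 - X 1) = Polynomial.X - Polynomial.C 1 := by
  have h : gradeHom K (X 0 - X 1) =
      Polynomial.C (Polynomial.X - Polynomial.C 1) * Polynomial.X := by
    simp [gradeHom, sub_mul]
  rw [leadingForm_apply, h, Polynomial.leadingCoeff_mul_X, Polynomial.leadingCoeff_C]

theorem restrictLine_X_sub_X (b : K) :
    restrictLine b (X 0 - X 1) = Polynomial.X - Polynomial.C b := by
  simp [restrictLine]

section Quotient

variable {t : ℕ} {G : MvPolynomial (Fin 2) K} (hG : differencePoly K t = (X 0 - X 1) * G)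
  (ht : (t : K) ≠ 0)

include hG ht

theorem C_mul_X_pow_sub_one_eq (ht2 : 2 ≤ t) :
    Polynomial.C (t : K) * (Polynomial.X ^ (t - 1) - 1) =
      (Polynomial.X - Polynomial.C 1) * leadingForm K G := by
  rw [← leadingForm_differencePoly ht ht2, hG, map_mul, leadingForm_X_sub_X]

theorem squarefree_leadingForm (ht2 : 2 ≤ t) (ht1 : ((t - 1 : ℕ) : K) ≠ 0) :
    Squarefree (leadingForm K G) := by
  have h : leadingForm K G ∣ Polynomial.X ^ (t - 1) - 1 := by
    rw [← (Polynomial.isUnit_C.2 (isUnit_iff_ne_zero.2 ht)).dvd_mul_left,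
      C_mul_X_pow_sub_one_eq hG ht ht2]
    exact dvd_mul_left _ _
  exact (Polynomial.X_pow_sub_one_separable_iff.2 ht1).squarefree.squarefree_of_dvd h

theorem natDegree_leadingForm (ht2 : 2 ≤ t) (h0 : leadingForm K G ≠ 0) :
    (leadingForm K G).natDegree = t - 2 := by
  have h := congrArg Polynomial.natDegree (C_mul_X_pow_sub_one_eq hG ht ht2)
  rw [Polynomial.natDegree_C_mul ht, ← Polynomial.C_1, Polynomial.natDegree_X_pow_sub_C,
    Polynomial.natDegree_mul (Polynomial.X_sub_C_ne_zero 1) h0,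
    Polynomial.natDegree_X_sub_C] at h
  omega

theorem isRoot_leadingForm_iff (ht2 : 2 ≤ t) {a : K} (ha : a ≠ 1) :
    (leadingForm K G).IsRoot a ↔ a ^ (t - 1) = 1 := by
  have h := congrArg (Polynomial.eval a) (C_mul_X_pow_sub_one_eq hG ht ht2)
  simp only [Polynomial.eval_mul, Polynomial.eval_C, Polynomial.eval_sub, Polynomial.eval_pow,
    Polynomial.eval_X, Polynomial.eval_one] at h
  rw [Polynomial.IsRoot.def, ← sub_eq_zero (a := a ^ (t - 1))]
  constructor <;> intro h'
  · simpa [h', ht] using h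
  · rw [h', mul_zero] at h
    exact (mul_eq_zero.1 h.symm).resolve_left (sub_ne_zero.2 ha)

theorem ne_zero_of_differencePoly_eq (ht2 : 2 ≤ t) : G ≠ 0 := by
  rintro rfl
  have h := leadingForm_differencePoly ht ht2
  rw [hG, mul_zero, leadingForm_apply, map_zero, Polynomial.leadingCoeff_zero] at h
  exact mul_ne_zero (Polynomial.C_ne_zero.2 ht)
      (Polynomial.X_pow_sub_C_ne_zero (by omega) 1) h.symm

theorem totalDegree_le_sub_two (ht2 : 2 ≤ t) : G.totalDegree ≤ t - 2 := by
  have h := totalDegree_differencePoly_le (K := K) t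
  have h1 := natDegree_leadingForm_le (X 0 - X 1 : MvPolynomial (Fin 2) K)
  rw [leadingForm_X_sub_X, Polynomial.natDegree_X_sub_C] at h1
  have hx : (X 0 - X 1 : MvPolynomial (Fin 2) K) ≠ 0 := by
    intro hx
    rw [hx, totalDegree_zero] at h1
    omega
  rw [hG, totalDegree_mul_of_isDomain hx (ne_zero_of_differencePoly_eq hG ht ht2)] at h
  omega

omit ht in
theorem X_add_one_pow_sub_X_pow_eq {b : K} (hb : (b + 1) ^ t = b ^ t) :
    ((Polynomial.X + 1) ^ t - Polynomial.X ^ t : Polynomial K) =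
      (Polynomial.X - Polynomial.C b) * restrictLine b G := by
  rw [← restrictLine_differencePoly t hb, hG, map_mul, restrictLine_X_sub_X]

theorem squarefree_restrictLine {b : K} (hb : (b + 1) ^ t = b ^ t) :
    Squarefree (restrictLine b G) := by
  have h : restrictLine b G ∣ (Polynomial.X + 1) ^ t - Polynomial.X ^ t := by
    rw [X_add_one_pow_sub_X_pow_eq hG hb]
    exact dvd_mul_left _ _
  exact (separable_X_add_one_pow_sub_X_pow ht).squarefree.squarefree_of_dvd h

theorem natDegree_restrictLine {b : K} (hb : (b + 1) ^ t = b ^ t)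
    (h0 : restrictLine b G ≠ 0) : (restrictLine b G).natDegree = t - 2 := by
  have h := congrArg Polynomial.natDegree (X_add_one_pow_sub_X_pow_eq hG hb)
  rw [natDegree_X_add_one_pow_sub_X_pow ht,
    Polynomial.natDegree_mul (Polynomial.X_sub_C_ne_zero b) h0,
    Polynomial.natDegree_X_sub_C] at h
  omega

omit ht in
theorem add_one_pow_eq_of_isRoot_restrictLine {a b : K} (hb : (b + 1) ^ t = b ^ t)
    (ha : (restrictLine b G).IsRoot a) : (a + 1) ^ t = a ^ t := by
  have h := congrArg (Polynomial.eval a) (X_add_one_pow_sub_X_pow_eq hG hb)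
  simpa [ha.eq_zero, sub_eq_zero] using h

omit ht in
theorem isRoot_restrictLine {a b : K} (hb : (b + 1) ^ t = b ^ t) (ha : (a + 1) ^ t = a ^ t)
    (hab : a ≠ b) : (restrictLine b G).IsRoot a := by
  have h := congrArg (Polynomial.eval a) (X_add_one_pow_sub_X_pow_eq hG hb)
  simpa [ha, sub_eq_zero, hab, eq_comm] using h

end Quotient

end Field

theorem map_eq_self_of_add_one_pow_eq {K : Type*} [Field K] (θ : K →+* K) {t : ℕ} (ht : t ≠ 0)
    (hθ : ∀ z : K, z ^ t = 1 → θ z = z) {a : K} (ha : (a + 1) ^ t = a ^ t) : θ a = a := by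
  have ha0 : a ≠ 0 := by
    rintro rfl
    simp [ht] at ha
  have h := hθ ((a + 1) / a) (by rw [div_pow, ha, div_self (pow_ne_zero t ha0)])
  rw [map_div₀, map_add, map_one, div_eq_div_iff ((map_ne_zero θ).2 ha0) ha0] at h
  linear_combination -h

theorem inv_sub_one_add_one_pow_eq {K : Type*} [Field K] {t : ℕ} {z : K} (hz : z ^ t = 1)
    (hz1 : z ≠ 1) : ((z - 1)⁻¹ + 1) ^ t = (z - 1)⁻¹ ^ t := by
  have h : (z - 1)⁻¹ + 1 = z * (z - 1)⁻¹ := by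
    have := sub_ne_zero.2 hz1
    field_simp
    ring
  rw [h, mul_pow, hz, one_mul]

theorem pow_orderOf_modEq_one (p n : ℕ) : p ^ orderOf (p : ZMod n) ≡ 1 [MOD n] := by
  rw [← ZMod.natCast_eq_natCast_iff, Nat.cast_pow, pow_orderOf_eq_one, Nat.cast_one]

theorem orderOf_natCast_dvd_of_dvd (p : ℕ) {d n : ℕ} (h : d ∣ n) :
    orderOf (p : ZMod d) ∣ orderOf (p : ZMod n) := by
  rw [← map_natCast (ZMod.castHom h (ZMod d)) p]
  exact orderOf_map_dvd _ _

section Frobenius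

variable {K : Type*} [Field K] {p : ℕ} [Fact p.Prime] [CharP K p]

theorem iterateFrobenius_orderOf_eq_self {n : ℕ} {z : K} (hz : z ^ n = 1) :
    iterateFrobenius K p (orderOf (p : ZMod n)) z = z := by
  rw [iterateFrobenius_def, pow_eq_pow_of_modEq (pow_orderOf_modEq_one p n) hz, pow_one]

theorem associated_map_frobenius_of_coprime {σ : Type*} {h : MvPolynomial σ K} {m n : ℕ}
    (hmn : m.Coprime n) (hm : Associated (map (iterateFrobenius K p m) h) h)
    (hn : Associated (map (iterateFrobenius K p n) h) h) :
    Associated (map (frobenius K p) h) h := by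
  let F : Associates (MvPolynomial σ K) → Associates (MvPolynomial σ K) :=
    Quotient.map (map (frobenius K p)) fun _ _ h => h.map (map (frobenius K p))
  have key : ∀ k, F^[k] (Associates.mk h) = Associates.mk (map (iterateFrobenius K p k) h) := by
    intro k
    induction k with
    | zero => simp [iterateFrobenius_zero, MvPolynomial.map_id]
    | succ k ih =>
      rw [Function.iterate_succ_apply', ih, Nat.add_comm, iterateFrobenius_add, ← map_map,
        iterateFrobenius_one]
      rfl
  have h1 : Function.IsPeriodicPt F 1 (Associates.mk h) := by
    rw [← hmn.gcd_eq_one]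
    exact Function.IsPeriodicPt.gcd ((key m).trans (Associates.mk_eq_mk_iff_associated.2 hm))
      ((key n).trans (Associates.mk_eq_mk_iff_associated.2 hn))
  exact Associates.mk_eq_mk_iff_associated.1 h1

variable [Algebra (ZMod p) K]

theorem exists_map_eq_of_map_frobenius_eq {σ : Type*} {P : MvPolynomial σ K}
    (hP : map (frobenius K p) P = P) : ∃ Q, map (algebraMap (ZMod p) K) Q = P := by
  refine mem_range_map_iff_coeffs_subset.2 fun c hc => ?_
  obtain ⟨m, -, rfl⟩ := mem_coeffs_iff.1 hc
  have h : P.coeff m ^ p = P.coeff m := by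
    conv_rhs => rw [← hP, coeff_map, frobenius_def]
  have h' := (Subfield.mem_bot_iff_pow_eq_self K p).2 h
  exact (bot_le : ⊥ ≤ (algebraMap (ZMod p) K).fieldRange) h'

theorem map_frobenius_map_algebraMap {σ : Type*} (Q : MvPolynomial σ (ZMod p)) :
    map (frobenius K p) (map (algebraMap (ZMod p) K) Q) = map (algebraMap (ZMod p) K) Q := by
  rw [map_map]
  congr 2
  exact Subsingleton.elim _ _

theorem exists_dvd_of_associated_map_frobenius [IsAlgClosed K] {σ : Type*}
    {g : MvPolynomial σ (ZMod p)} {h : MvPolynomial σ K} (hh : Irreducible h)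
    (hd : h ∣ map (algebraMap (ZMod p) K) g) (ha : Associated h (map (frobenius K p) h)) :
    ∃ q, q ∣ g ∧ Irreducible (map (algebraMap (ZMod p) K) q) := by
  have hp : p.Prime := Fact.out
  obtain ⟨u, hu⟩ := ha
  obtain ⟨c, hc, hcu⟩ := MvPolynomial.isUnit_iff_eq_C_of_isReduced.1 u.isUnit
  obtain ⟨w, hw⟩ := IsAlgClosed.exists_pow_nat_eq c⁻¹ (Nat.sub_pos_of_lt hp.one_lt)
  have hw0 : w ≠ 0 := by
    rintro rfl
    rw [zero_pow (Nat.sub_pos_of_lt hp.one_lt).ne'] at hw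
    exact inv_ne_zero hc.ne_zero hw.symm
  have hwc : w ^ p * c = w := by
    rw [← Nat.sub_add_cancel hp.one_le, pow_succ, hw, mul_right_comm,
      inv_mul_cancel₀ hc.ne_zero, one_mul]
  have hfix : map (frobenius K p) (C w * h) = C w * h := by
    rw [map_mul, map_C, ← hu, hcu, frobenius_def]
    conv_rhs => rw [← hwc, C_mul]
    ring
  have hassoc : Associated (C w * h) h :=
    associated_unit_mul_left _ _ ((isUnit_iff_ne_zero.2 hw0).map C)
  obtain ⟨q, hq⟩ := exists_map_eq_of_map_frobenius_eq hfix
  have hirr : Irreducible (map (algebraMap (ZMod p) K) q) := hq ▸ hassoc.irreducible_iff.2 hh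
  obtain ⟨k, hk⟩ := hassoc.dvd.trans hd
  rw [← hq] at hk
  obtain ⟨r, hr⟩ : ∃ r, map (algebraMap (ZMod p) K) r = k := by
    refine exists_map_eq_of_map_frobenius_eq (mul_left_cancel₀ hirr.ne_zero ?_)
    conv_lhs => rw [← map_frobenius_map_algebraMap q]
    rw [← map_mul, ← hk, map_frobenius_map_algebraMap]
  refine ⟨q, ⟨r, map_injective _ (algebraMap (ZMod p) K).injective ?_⟩, hirr⟩
  rw [hk, map_mul, hr]

variable [IsAlgClosed K]

theorem associated_map_iterateFrobenius_of_isRoot {σ : Type*}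
    (φ : MvPolynomial σ K →* Polynomial K) {m : ℕ}
    (hφ : ∀ q, φ (map (iterateFrobenius K p m) q) = (φ q).map (iterateFrobenius K p m))
    {g : MvPolynomial σ (ZMod p)} {h : MvPolynomial σ K}
    (hsq : Squarefree (φ (map (algebraMap (ZMod p) K) g))) (hh : Irreducible h)
    (hd : h ∣ map (algebraMap (ZMod p) K) g) {a : K} (ha : (φ h).IsRoot a)
    (hfix : iterateFrobenius K p m a = a) :
    Associated (map (iterateFrobenius K p m) h) h := by
  refine associated_map_of_isRoot φ (mapEquiv σ (iterateFrobeniusEquiv K p m))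
    (iterateFrobenius K p m) hφ hsq ?_ hh hd ha hfix
  change map (iterateFrobenius K p m) (map _ g) = _
  rw [map_map]
  congr 2
  exact Subsingleton.elim _ _

end Frobenius

section Components

variable {K : Type*} [Field K] {p : ℕ} [Fact p.Prime] [CharP K p] [Algebra (ZMod p) K]
  [IsAlgClosed K] {t : ℕ} {g : MvPolynomial (Fin 2) (ZMod p)}
  (hG : differencePoly K t = (X 0 - X 1) * map (algebraMap (ZMod p) K) g)
  (ht : (t : K) ≠ 0) (ht2 : 2 ≤ t)
  {h : MvPolynomial (Fin 2) K} (hh : Irreducible h) (hd : h ∣ map (algebraMap (ZMod p) K) g)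

include hG ht ht2 hh hd

theorem associated_map_iterateFrobenius_orderOf_sub_one (ht1 : ((t - 1 : ℕ) : K) ≠ 0) :
    Associated (map (iterateFrobenius K p (orderOf (p : ZMod (t - 1)))) h) h := by
  have hsq := squarefree_leadingForm hG ht ht2 ht1
  obtain ⟨a, ha⟩ := exists_isRoot_map_of_dvd (leadingForm K) natDegree_leadingForm_le hsq.ne_zero
    (ne_zero_of_differencePoly_eq hG ht ht2)
    ((totalDegree_le_sub_two hG ht ht2).trans (natDegree_leadingForm hG ht ht2 hsq.ne_zero).ge)
    hd hh
  refine associated_map_iterateFrobenius_of_isRoot (leadingForm K) (leadingForm_map _) hsq hh hd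
    ha (iterateFrobenius_orderOf_eq_self ?_)
  by_cases ha1 : a = 1
  · rw [ha1, one_pow]
  · exact (isRoot_leadingForm_iff hG ht ht2 ha1).1 (ha.dvd (map_dvd (leadingForm K) hd))

theorem associated_map_iterateFrobenius_orderOf (ht3 : ∃ z : K, z ^ t = 1 ∧ z ≠ 1) :
    Associated (map (iterateFrobenius K p (orderOf (p : ZMod t))) h) h := by
  obtain ⟨z, hz, hz1⟩ := ht3
  have hb := inv_sub_one_add_one_pow_eq hz hz1
  set b := (z - 1)⁻¹
  have hsq := squarefree_restrictLine hG ht hb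
  obtain ⟨a, ha⟩ := exists_isRoot_map_of_dvd
    (restrictLine b : MvPolynomial (Fin 2) K →* Polynomial K) (natDegree_restrictLine_le b)
    hsq.ne_zero (ne_zero_of_differencePoly_eq hG ht ht2)
    ((totalDegree_le_sub_two hG ht ht2).trans (natDegree_restrictLine hG ht hb hsq.ne_zero).ge)
    hd hh
  have hfix : ∀ a : K, (a + 1) ^ t = a ^ t →
      iterateFrobenius K p (orderOf (p : ZMod t)) a = a := fun a =>
    map_eq_self_of_add_one_pow_eq _ (by omega) fun z hz => iterateFrobenius_orderOf_eq_self hz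
  exact associated_map_iterateFrobenius_of_isRoot
    (restrictLine b : MvPolynomial (Fin 2) K →* Polynomial K) (restrictLine_map _ (hfix b hb))
    hsq hh hd ha
    (hfix a (add_one_pow_eq_of_isRoot_restrictLine hG hb
      (ha.dvd (map_dvd (restrictLine b) hd))))

end Components

section Points

variable {K : Type*} [Field K] {p : ℕ} [Fact p.Prime] [CharP K p] [Algebra (ZMod p) K]
  {t : ℕ} {g : MvPolynomial (Fin 2) (ZMod p)}
  (hG : differencePoly K t = (X 0 - X 1) * map (algebraMap (ZMod p) K) g)
  (ht : (t : K) ≠ 0) (ht2 : 2 ≤ t)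

include hG ht ht2

theorem exists_irreducible_dvd_of_isPrimitiveRoot_sub_one [IsAlgClosed K]
    (ht1 : ((t - 1 : ℕ) : K) ≠ 0)
    {d : ℕ} (hd : d ∣ t - 1) (hd1 : 1 < d) {z : K} (hz : IsPrimitiveRoot z d) :
    ∃ h, Irreducible h ∧ h ∣ map (algebraMap (ZMod p) K) g ∧
      Associated (map (iterateFrobenius K p (orderOf (p : ZMod d))) h) h := by
  have hroot : (leadingForm K (map (algebraMap (ZMod p) K) g)).IsRoot z :=
    (isRoot_leadingForm_iff hG ht ht2 (hz.ne_one hd1)).2 ((hz.pow_eq_one_iff_dvd _).2 hd)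
  obtain ⟨h, hh, hdvd, h0⟩ := exists_irreducible_dvd_map_eq_zero
    ((Polynomial.evalRingHom z : Polynomial K →* K).comp (leadingForm K))
    (ne_zero_of_differencePoly_eq hG ht ht2) hroot
  exact ⟨h, hh, hdvd, associated_map_iterateFrobenius_of_isRoot (leadingForm K)
    (leadingForm_map _) (squarefree_leadingForm hG ht ht2 ht1) hh hdvd h0
    (iterateFrobenius_orderOf_eq_self hz.pow_eq_one)⟩

theorem exists_irreducible_dvd_of_isPrimitiveRoot [IsAlgClosed K]
    {d : ℕ} (hd : d ∣ t) (hd2 : 2 < d) {z : K} (hz : IsPrimitiveRoot z d) :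
    ∃ h, Irreducible h ∧ h ∣ map (algebraMap (ZMod p) K) g ∧
      Associated (map (iterateFrobenius K p (orderOf (p : ZMod d))) h) h := by
  have hz1 : z ≠ 1 := hz.ne_one (by omega)
  have hinv1 : z⁻¹ ≠ 1 := inv_ne_one.2 hz1
  have hne : (z - 1)⁻¹ ≠ (z⁻¹ - 1)⁻¹ := by
    intro h
    rw [inv_inj, sub_left_inj, ← mul_eq_one_iff_eq_inv₀ (hz.ne_zero (by omega)), ← sq,
      hz.pow_eq_one_iff_dvd] at h
    exact absurd (Nat.le_of_dvd two_pos h) (by omega)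
  have hpow : ∀ n, d ∣ n → ((z - 1)⁻¹ + 1) ^ n = (z - 1)⁻¹ ^ n := fun n hn =>
    inv_sub_one_add_one_pow_eq ((hz.pow_eq_one_iff_dvd _).2 hn) hz1
  have hpow' : ∀ n, d ∣ n → ((z⁻¹ - 1)⁻¹ + 1) ^ n = (z⁻¹ - 1)⁻¹ ^ n := fun n hn =>
    inv_sub_one_add_one_pow_eq ((hz.inv.pow_eq_one_iff_dvd _).2 hn) hinv1
  set a := (z - 1)⁻¹
  set b := (z⁻¹ - 1)⁻¹
  have hfix : ∀ a : K, (a + 1) ^ d = a ^ d →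
      iterateFrobenius K p (orderOf (p : ZMod d)) a = a := fun a =>
    map_eq_self_of_add_one_pow_eq _ (by omega) fun z hz => iterateFrobenius_orderOf_eq_self hz
  obtain ⟨h, hh, hdvd, h0⟩ := exists_irreducible_dvd_map_eq_zero
    ((Polynomial.evalRingHom a : Polynomial K →* K).comp
      (restrictLine b : MvPolynomial (Fin 2) K →* Polynomial K))
    (ne_zero_of_differencePoly_eq hG ht ht2)
    (isRoot_restrictLine hG (hpow' t hd) (hpow t hd) hne)
  exact ⟨h, hh, hdvd, associated_map_iterateFrobenius_of_isRoot
    (restrictLine b : MvPolynomial (Fin 2) K →* Polynomial K)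
    (restrictLine_map _ (hfix b (hpow' d dvd_rfl)))
    (squarefree_restrictLine hG ht (hpow' t hd)) hh hdvd h0 (hfix a (hpow d dvd_rfl))⟩

end Points

/-- Case (A), condition (f): writing `e_n` for the multiplicative order of `p`
modulo `n` and `e = gcd(e_{t-1}, e_t)`, if there is a divisor `d > 2` of `t`
with `gcd(e, e_d) = 1`, or a divisor `d > 1` of `t-1` with `gcd(e, e_d) = 1`,
then `g_t` has an absolutely irreducible factor over `F_p`. -/
theorem gt_has_abs_irred_factor_of_orders
    (p t : ℕ) [Fact p.Prime] (hp2 : p ≠ 2) (ht : 3 ≤ t) (hpt : ¬ p ∣ t)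
    (g : MvPolynomial (Fin 2) (ZMod p))
    (hg : ((X 0 + 1) ^ t - X 0 ^ t - (X 1 + 1) ^ t + X 1 ^ t : MvPolynomial (Fin 2) (ZMod p))
        = (X 0 - X 1) * g)
    (hte : Even t) (h0 : t % p ≠ 0) (h1 : t % p ≠ 1)
    (hcond :
      (∃ d : ℕ, d ∣ t ∧ 2 < d ∧
        Nat.gcd (Nat.gcd (orderOf ((p : ZMod (t - 1)))) (orderOf ((p : ZMod t))))
          (orderOf ((p : ZMod d))) = 1) ∨
      (∃ d : ℕ, d ∣ (t - 1) ∧ 1 < d ∧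
        Nat.gcd (Nat.gcd (orderOf ((p : ZMod (t - 1)))) (orderOf ((p : ZMod t))))
          (orderOf ((p : ZMod d))) = 1)) :
    ∃ h : MvPolynomial (Fin 2) (ZMod p), 0 < h.totalDegree ∧ h ∣ g ∧
      Irreducible (MvPolynomial.map (algebraMap (ZMod p) (AlgebraicClosure (ZMod p))) h) := by
  set K := AlgebraicClosure (ZMod p)
  have hp : p.Prime := Fact.out
  have hcast : ∀ n : ℕ, ¬ p ∣ n → (n : K) ≠ 0 := fun n hn => by
    rwa [Ne, CharP.cast_eq_zero_iff K p]
  have htK : (t : K) ≠ 0 := hcast t hpt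
  have hpt1 : ¬ p ∣ t - 1 := fun h => h1 <| by
    rw [← Nat.mod_eq_of_lt hp.one_lt]
    exact ((Nat.modEq_iff_dvd' (by omega)).2 h).symm
  have ht1K : ((t - 1 : ℕ) : K) ≠ 0 := hcast _ hpt1
  have hG : differencePoly K t = (X 0 - X 1) * map (algebraMap (ZMod p) K) g := by
    simpa [differencePoly] using congrArg (map (algebraMap (ZMod p) K)) hg
  have hroot : ∀ d n : ℕ, d ∣ n → ¬ p ∣ n → ∃ z : K, IsPrimitiveRoot z d := fun d n hd hn => by
    have : NeZero (d : K) := ⟨hcast d fun h => hn (h.trans hd)⟩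
    exact HasEnoughRootsOfUnity.exists_primitiveRoot K d
  obtain ⟨h, hh, hdvd, hfrob⟩ : ∃ h : MvPolynomial (Fin 2) K, Irreducible h ∧
      h ∣ map (algebraMap (ZMod p) K) g ∧ Associated (map (frobenius K p) h) h := by
    rcases hcond with ⟨d, hd, hd2, hgcd⟩ | ⟨d, hd, hd1, hgcd⟩
    · obtain ⟨z, hz⟩ := hroot d t hd hpt
      obtain ⟨h, hh, hdvd, hass⟩ :=
        exists_irreducible_dvd_of_isPrimitiveRoot hG htK (by omega) hd hd2 hz
      rw [Nat.gcd_assoc, Nat.gcd_eq_right (orderOf_natCast_dvd_of_dvd p hd)] at hgcd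
      exact ⟨h, hh, hdvd, associated_map_frobenius_of_coprime hgcd
        (associated_map_iterateFrobenius_orderOf_sub_one hG htK (by omega) hh hdvd ht1K) hass⟩
    · obtain ⟨z, hz⟩ := hroot d (t - 1) hd hpt1
      obtain ⟨h, hh, hdvd, hass⟩ :=
        exists_irreducible_dvd_of_isPrimitiveRoot_sub_one hG htK (by omega) ht1K hd hd1 hz
      rw [Nat.gcd_comm (orderOf _), Nat.gcd_assoc,
        Nat.gcd_eq_right (orderOf_natCast_dvd_of_dvd p hd)] at hgcd
      obtain ⟨ξ, hξ⟩ := hroot t t dvd_rfl hpt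
      exact ⟨h, hh, hdvd, associated_map_frobenius_of_coprime hgcd
        (associated_map_iterateFrobenius_orderOf hG htK (by omega) hh hdvd
          ⟨ξ, hξ.pow_eq_one, hξ.ne_one (by omega)⟩) hass⟩
  obtain ⟨q, hq, hirr⟩ := exists_dvd_of_associated_map_frobenius hh hdvd hfrob.symm
  refine ⟨q, ?_, hq, hirr⟩
  exact hirr.totalDegree_pos.trans_le (Finset.sup_mono (support_map_subset _ _))
end
end
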